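/- arXiv:1701.02695 — 4 statements merged into one kernel-verified Lean document; each statement's English description precedes it below -/
import Mathlib

section
/- Let k ≥ 4. Each of the following two permutations π of {1,…,2k+1} is realized by a second minimal (2k+1)-orbit of some continuous map f : ℝ → ℝ: (a) π agrees with the Stefan permutation π_S except π(2) = 2k, π(3) = 2k+1, π(2k) = 1, π(2k+1) = 2; (b) π agrees with π_S except π(2k−1) = 2, π(2k) = 1, π(2k+1) = 3. -/
/-- `x` is a periodic point of `f` of (exact) period `n`. -/
def PeriodicPtOfPeriod (f : ℝ → ℝ) (n : ℕ) (x : ℝ) : Prop :=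
  f^[n] x = x ∧ ∀ j, 1 ≤ j → j < n → f^[j] x ≠ x

/-- `β 1 < β 2 < ⋯ < β m` is an `m`-orbit of `f` with permutation `σ`:
each `β t` is a periodic point of period `m`, `σ` permutes `{1,…,m}`,
and `f (β t) = β (σ t)`. -/
def IsOrbitWithPerm (f : ℝ → ℝ) (m : ℕ) (β : ℕ → ℝ) (σ : ℕ → ℕ) : Prop :=
  StrictMonoOn β (Set.Icc 1 m) ∧
  (∀ t ∈ Set.Icc 1 m, PeriodicPtOfPeriod f m (β t)) ∧
  Set.BijOn σ (Set.Icc 1 m) (Set.Icc 1 m) ∧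
  (∀ t ∈ Set.Icc 1 m, f (β t) = β (σ t))

/-- A `(2k+1)`-orbit `β` of `f` is second minimal: `f` has a periodic point of
period `2k−1` with forward orbit in `[β 1, β (2k+1)]`, and no periodic point of
odd period `q` with `1 < q < 2k−1` whose forward orbit lies in `[β 1, β (2k+1)]`. -/
def SecondMinimalOrbit (f : ℝ → ℝ) (k : ℕ) (β : ℕ → ℝ) : Prop :=
  (∃ y, PeriodicPtOfPeriod f (2*k-1) y ∧
      ∀ j : ℕ, f^[j] y ∈ Set.Icc (β 1) (β (2*k+1))) ∧
  ∀ q, Odd q → 1 < q → q < 2*k-1 →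
    ¬ ∃ y, PeriodicPtOfPeriod f q y ∧
        ∀ j : ℕ, f^[j] y ∈ Set.Icc (β 1) (β (2*k+1))

/-- The Stefan permutation of `{1,…,2k+1}`. -/
def stefanPerm (k : ℕ) (t : ℕ) : ℕ :=
  if t = 1 then k+1 else if t ≤ k+1 then 2*k+3-t else 2*k+2-t

/-- The permutation `π` of `{1,…,2k+1}` is realized by a second minimal
`(2k+1)`-orbit of some continuous map. -/
def RealizedSM (k : ℕ) (π : ℕ → ℕ) : Prop :=
  ∃ f : ℝ → ℝ, ∃ β : ℕ → ℝ, Continuous f ∧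
    IsOrbitWithPerm f (2*k+1) β π ∧ SecondMinimalOrbit f k β

/-- `f` maps `[1, 2k+1]` into itself, agrees with the piecewise linear Stefan map on `[4, 2k-2]`,
and takes `2k-1 ↦ u ↦ 2k+1 ↦ v ↦ 2k ↦ 1 ↦ k+1` with `{u, v} = {2, 3}`. -/
structure IsStefanLike (k : ℕ) (f : ℝ → ℝ) : Prop where
  continuous : Continuous f
  four_le : 4 ≤ k
  first : ∀ x : ℝ, 1 ≤ x → x ≤ 2 → k + 1 ≤ f x ∧ f x ≤ 2 * k + 1
  left : ∀ x : ℝ, 2 ≤ x → x ≤ 4 → 2 * k - 1 ≤ f x ∧ f x ≤ 2 * k + 1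
  midLeft : ∀ x : ℝ, 4 ≤ x → x ≤ k + 1 → f x = 2 * k + 3 - x
  center : ∀ x : ℝ, k + 1 ≤ x → x ≤ k + 2 → f x = 3 * k + 4 - 2 * x
  midRight : ∀ x : ℝ, k + 2 ≤ x → x ≤ 2 * k - 2 → f x = 2 * k + 2 - x
  right : ∀ x : ℝ, 2 * k - 2 ≤ x → x ≤ 2 * k - 1 → 2 ≤ f x ∧ f x ≤ 4
  last : ∀ x : ℝ, 2 * k - 1 ≤ x → x ≤ 2 * k + 1 → 1 ≤ f x ∧ f x ≤ 3
  map_map_middle : f (f (2 * k - 3 / 2)) = 2 * k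
  map_two_mul : f (2 * k) = 1
  map_one : f 1 = k + 1
  orbit_tail : ∃ u v : ℝ, ((u = 2 ∧ v = 3) ∨ (u = 3 ∧ v = 2)) ∧ f (2 * k - 1) = u ∧
    f u = 2 * k + 1 ∧ f (2 * k + 1) = v ∧ f v = 2 * k

namespace IsStefanLike

variable {k : ℕ} {f : ℝ → ℝ}

theorem four_le_cast (h : IsStefanLike k f) : (4 : ℝ) ≤ k := by exact_mod_cast h.four_le

theorem map_fixed (h : IsStefanLike k f) : f (k + 4 / 3) = k + 4 / 3 := by
  rw [h.center _ (by linarith) (by linarith)]; ring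

/-- Points to the right of the fixed point `k + 4/3` move to its left. -/
theorem map_of_gt (h : IsStefanLike k f) {x : ℝ} (hx : k + 4 / 3 < x) (hx' : x ≤ 2 * k + 1) :
    1 ≤ f x ∧ f x < k + 4 / 3 := by
  have hk := h.four_le_cast
  rcases le_total x (k + 2) with h1 | h1
  · have := h.center x (by linarith) h1
    constructor <;> linarith
  rcases le_total x (2 * k - 2) with h2 | h2
  · have := h.midRight x h1 h2
    constructor <;> linarith
  rcases le_total x (2 * k - 1) with h3 | h3
  · have := h.right x h2 h3
    constructor <;> linarith
  · have := h.last x h3 hx'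
    constructor <;> linarith

/-- Points of `[2, k + 4/3)` move to the right of the fixed point `k + 4/3`. -/
theorem map_of_lt (h : IsStefanLike k f) {x : ℝ} (hx : 2 ≤ x) (hx' : x < k + 4 / 3) :
    k + 4 / 3 < f x ∧ f x ≤ 2 * k + 1 := by
  have hk := h.four_le_cast
  rcases le_total x 4 with h1 | h1
  · have := h.left x hx h1
    constructor <;> linarith
  rcases le_total x (k + 1) with h2 | h2
  · have := h.midLeft x h1 h2
    constructor <;> linarith
  · have := h.center x h2 (by linarith)
    constructor <;> linarith

theorem mapsTo (h : IsStefanLike k f) :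
    Set.MapsTo f (Set.Icc 1 (2 * k + 1)) (Set.Icc 1 (2 * k + 1)) := by
  rintro x ⟨h1, h2⟩
  have hk := h.four_le_cast
  rcases le_total x 2 with h3 | h3
  · have := h.first x h1 h3
    exact ⟨by linarith, this.2⟩
  rcases lt_trichotomy x (k + 4 / 3) with h4 | h4 | h4
  · have := h.map_of_lt h3 h4
    exact ⟨by linarith, this.2⟩
  · rw [h4, h.map_fixed]
    constructor <;> linarith
  · have := h.map_of_gt h4 h2
    exact ⟨this.1, by linarith⟩

theorem iterate_mem (h : IsStefanLike k f) {x : ℝ} (hx : x ∈ Set.Icc (1 : ℝ) (2 * k + 1)) (n : ℕ) :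
    f^[n] x ∈ Set.Icc (1 : ℝ) (2 * k + 1) :=
  h.mapsTo.iterate n hx

theorem iterate_two_mul_bounds (h : IsStefanLike k f) {y : ℝ} (hy : k + 1 ≤ y)
    (hy' : y < k + 4 / 3) (i : ℕ) (hi : i + 3 ≤ k) :
    k + 1 - i ≤ f^[2 * i] y ∧ f^[2 * i] y < k + 4 / 3 := by
  have hk := h.four_le_cast
  induction i with
  | zero => simpa using ⟨hy, hy'⟩
  | succ i ih =>
    obtain ⟨h1, h2⟩ := ih (by omega)
    have hi' : (i : ℝ) + 4 ≤ k := by exact_mod_cast (by omega : i + 4 ≤ k)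
    rw [show 2 * (i + 1) = 2 * i + 1 + 1 by ring, Function.iterate_succ_apply',
      Function.iterate_succ_apply']
    set x := f^[2 * i] y
    obtain ⟨h3, h4⟩ := h.map_of_lt (by linarith) h2
    refine ⟨?_, (h.map_of_gt h3 h4).2⟩
    push_cast
    rcases le_total x (k + 1) with h5 | h5
    · rw [h.midLeft x (by linarith) h5, h.midRight _ (by linarith) (by linarith)]
      linarith
    · rw [h.center x h5 (by linarith), h.center _ (by linarith) (by linarith)]
      linarith

theorem lt_iterate_odd (h : IsStefanLike k f) {y : ℝ} (hy : k + 1 ≤ y)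
    (hy' : y < k + 4 / 3) (i : ℕ) (hi : i + 2 ≤ k) :
    k + 4 / 3 < f^[2 * i + 1] y := by
  have hk := h.four_le_cast
  rw [Function.iterate_succ_apply']
  rcases Nat.lt_or_ge (i + 2) k with hlt | hge
  · obtain ⟨h1, h2⟩ := h.iterate_two_mul_bounds hy hy' i (by omega)
    have hi' : (i : ℝ) + 3 ≤ k := by exact_mod_cast (by omega : i + 3 ≤ k)
    exact (h.map_of_lt (by linarith) h2).1
  · obtain ⟨j, rfl⟩ : ∃ j, i = j + 1 := ⟨i - 1, by have := h.four_le; omega⟩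
    obtain ⟨h1, h2⟩ := h.iterate_two_mul_bounds hy hy' j (by omega)
    have hj : (j : ℝ) + 3 = k := by exact_mod_cast (by omega : j + 3 = k)
    rw [show 2 * (j + 1) = 2 * j + 1 + 1 by ring, Function.iterate_succ_apply',
      Function.iterate_succ_apply']
    set x := f^[2 * j] y
    obtain ⟨h3, h4⟩ := h.map_of_lt (by linarith) h2
    refine (h.map_of_lt ?_ (h.map_of_gt h3 h4).2).1
    rcases le_total x (k + 1) with h5 | h5
    · have h6 := h.midLeft x (by linarith) h5
      rcases le_total (f x) (2 * k - 2) with h7 | h7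
      · rw [h.midRight (f x) (by linarith) h7]
        linarith
      · exact (h.right (f x) h7 (by linarith)).1
    · rw [h.center x h5 (by linarith), h.center _ (by linarith) (by linarith)]
      linarith

/-- A point of `[1, 2k+1]` returning after an odd number `q < 2k - 1` of steps is fixed. -/
theorem fixed_of_odd_return (h : IsStefanLike k f) {q : ℕ} (hq : Odd q) (hqk : q < 2 * k - 1)
    {x : ℝ} (hx : x ∈ Set.Icc (1 : ℝ) (2 * k + 1)) (hqx : f^[q] x = x) : f x = x := by
  by_contra hne
  have hk := h.four_le_cast
  have hc : ∀ n, f^[n] x ≠ k + 4 / 3 := by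
    intro n hn
    have hper : Function.IsPeriodicPt f (q * n) x := Function.IsPeriodicPt.mul_const hqx n
    have hqn : q * n = (q * n - n) + n :=
      (Nat.sub_add_cancel (Nat.le_mul_of_pos_left n hq.pos)).symm
    have hxc : x = k + 4 / 3 := by
      have := hper.eq
      rwa [hqn, Function.iterate_add_apply, hn,
        Function.iterate_fixed h.map_fixed, eq_comm] at this
    exact hne (hxc ▸ h.map_fixed)
  obtain ⟨n, h1, h2⟩ : ∃ n, f^[n] x < k + 4 / 3 ∧ f^[n + 1] x < k + 4 / 3 := by
    by_contra! hall
    have hpar : ∀ n, (f^[n] x < k + 4 / 3 ↔ (Even n ↔ x < k + 4 / 3)) := by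
      intro n
      induction n with
      | zero => simp
      | succ n ih =>
        have : f^[n + 1] x < k + 4 / 3 ↔ ¬ f^[n] x < k + 4 / 3 := by
          constructor
          · intro h1 h2
            exact absurd h1 (not_lt.2 (hall n h2))
          · intro h1
            rw [Function.iterate_succ_apply']
            exact (h.map_of_gt (lt_of_le_of_ne (not_lt.1 h1) (hc n).symm)
              (h.iterate_mem hx n).2).2
        rw [this, ih, Nat.even_add_one]
        tauto
    have := hpar q
    rw [hqx] at this
    have hodd := Nat.not_even_iff_odd.2 hq
    tauto
  have h3 : f^[n] x < 2 := by
    by_contra! h3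
    have := (h.map_of_lt h3 h1).1
    rw [← Function.iterate_succ_apply' f] at this
    exact lt_asymm this h2
  have h4 : k + 1 ≤ f^[n + 1] x := by
    rw [Function.iterate_succ_apply']
    exact (h.first _ (h.iterate_mem hx n).1 h3.le).1
  obtain ⟨i, rfl⟩ := hq
  have h5 := h.lt_iterate_odd h4 h2 i (by omega)
  rw [← Function.iterate_add_apply, Nat.add_comm, Function.iterate_add_apply, hqx] at h5
  exact lt_asymm h5 h2

theorem iterate_two_mul_eq_sub (h : IsStefanLike k f) {z : ℝ} (hz : z ≤ k + 1) (i : ℕ)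
    (hi : 4 + i ≤ z) : f^[2 * i] z = z - i := by
  induction i with
  | zero => simp
  | succ i ih =>
    push_cast at hi
    have hi' : (0 : ℝ) ≤ i := i.cast_nonneg
    rw [show 2 * (i + 1) = 2 * i + 1 + 1 by ring, Function.iterate_succ_apply',
      Function.iterate_succ_apply', ih (by linarith),
      h.midLeft (z - i) (by linarith) (by linarith),
      h.midRight _ (by linarith) (by linarith)]
    push_cast
    ring

theorem iterate_even (h : IsStefanLike k f) {i : ℕ} (hi : i + 3 ≤ k) :
    f^[2 * i] (k + 1) = k + 1 - i := by
  have hi' : (i : ℝ) + 3 ≤ k := by exact_mod_cast hi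
  exact h.iterate_two_mul_eq_sub le_rfl i (by linarith)

theorem iterate_odd (h : IsStefanLike k f) {i : ℕ} (hi : i + 3 ≤ k) :
    f^[2 * i + 1] (k + 1) = k + 2 + i := by
  have hi' : (i : ℝ) + 3 ≤ k := by exact_mod_cast hi
  have hi0 : (0 : ℝ) ≤ i := i.cast_nonneg
  rw [Function.iterate_succ_apply', h.iterate_even hi, h.midLeft _ (by linarith) (by linarith)]
  ring

theorem iterate_tail (h : IsStefanLike k f) :
    ∃ u v : ℝ, ((u = 2 ∧ v = 3) ∨ (u = 3 ∧ v = 2)) ∧ f^[2 * k - 4] (k + 1) = u ∧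
      f^[2 * k - 3] (k + 1) = 2 * k + 1 ∧ f^[2 * k - 2] (k + 1) = v ∧
      f^[2 * k - 1] (k + 1) = 2 * k ∧ f^[2 * k] (k + 1) = 1 ∧ f^[2 * k + 1] (k + 1) = k + 1 := by
  obtain ⟨u, v, huv, h1, h2, h3, h4⟩ := h.orbit_tail
  obtain ⟨m, hm⟩ : ∃ m, m + 3 = k := ⟨k - 3, by have := h.four_le; omega⟩
  have hm' : (m : ℝ) = k - 3 := by rw [← hm]; push_cast; ring
  have e1 : f^[2 * m + 1] (k + 1) = 2 * k - 1 := by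
    rw [h.iterate_odd hm.le, hm']; ring
  have e2 : f^[2 * k - 4] (k + 1) = u := by
    rw [show 2 * k - 4 = 2 * m + 1 + 1 by omega, Function.iterate_succ_apply', e1, h1]
  have e3 : f^[2 * k - 3] (k + 1) = 2 * k + 1 := by
    rw [show 2 * k - 3 = 2 * k - 4 + 1 by omega, Function.iterate_succ_apply', e2, h2]
  have e4 : f^[2 * k - 2] (k + 1) = v := by
    rw [show 2 * k - 2 = 2 * k - 3 + 1 by omega, Function.iterate_succ_apply', e3, h3]
  have e5 : f^[2 * k - 1] (k + 1) = 2 * k := by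
    rw [show 2 * k - 1 = 2 * k - 2 + 1 by omega, Function.iterate_succ_apply', e4, h4]
  have e6 : f^[2 * k] (k + 1) = 1 := by
    rw [show 2 * k = 2 * k - 1 + 1 by omega, Function.iterate_succ_apply', e5, h.map_two_mul]
  exact ⟨u, v, huv, e2, e3, e4, e5, e6, by rw [Function.iterate_succ_apply', e6, h.map_one]⟩

theorem iterate_ne (h : IsStefanLike k f) {j : ℕ} (hj : 1 ≤ j) (hj' : j < 2 * k + 1) :
    f^[j] (k + 1) ≠ k + 1 := by
  have hk := h.four_le_cast
  obtain ⟨u, v, huv, h1, h2, h3, h4, h5, -⟩ := h.iterate_tail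
  have hu : u ≤ 3 ∧ v ≤ 3 := by rcases huv with ⟨rfl, rfl⟩ | ⟨rfl, rfl⟩ <;> norm_num
  rcases Nat.lt_or_ge j (2 * k - 4) with hlt | hge
  · obtain ⟨i, rfl | rfl⟩ := j.even_or_odd'
    · have : (1 : ℝ) ≤ i := by exact_mod_cast (by omega : 1 ≤ i)
      rw [h.iterate_even (by omega)]
      linarith
    · have : (0 : ℝ) ≤ i := i.cast_nonneg
      rw [h.iterate_odd (by omega)]
      linarith
  · obtain rfl | rfl | rfl | rfl | rfl : j = 2 * k - 4 ∨ j = 2 * k - 3 ∨ j = 2 * k - 2 ∨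
      j = 2 * k - 1 ∨ j = 2 * k := by omega
    · rw [h1]; linarith
    · rw [h2]; linarith
    · rw [h3]; linarith
    · rw [h4]; linarith
    · rw [h5]; linarith

theorem exists_iterate_eq (h : IsStefanLike k f) {t : ℕ} (ht : t ∈ Set.Icc 1 (2 * k + 1)) :
    ∃ n, f^[n] (k + 1) = t := by
  have hk := h.four_le
  obtain ⟨u, v, huv, h1, h2, h3, h4, h5, -⟩ := h.iterate_tail
  obtain ⟨ht1, ht2⟩ := ht
  by_cases c1 : t = 1
  · exact ⟨_, by rw [h5, c1]; norm_num⟩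
  by_cases c2 : t = 2
  · rcases huv with ⟨rfl, rfl⟩ | ⟨rfl, rfl⟩
    · exact ⟨_, by rw [h1, c2]; norm_num⟩
    · exact ⟨_, by rw [h3, c2]; norm_num⟩
  by_cases c3 : t = 3
  · rcases huv with ⟨rfl, rfl⟩ | ⟨rfl, rfl⟩
    · exact ⟨_, by rw [h3, c3]; norm_num⟩
    · exact ⟨_, by rw [h1, c3]; norm_num⟩
  by_cases c4 : t = 2 * k
  · exact ⟨_, by rw [h4, c4]; push_cast; ring⟩
  by_cases c5 : t = 2 * k + 1
  · exact ⟨_, by rw [h2, c5]; push_cast; ring⟩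
  rcases Nat.lt_or_ge t (k + 2) with c6 | c6
  · refine ⟨2 * (k + 1 - t), ?_⟩
    rw [h.iterate_even (by omega), Nat.cast_sub (by omega)]
    push_cast; ring
  · refine ⟨2 * (t - (k + 2)) + 1, ?_⟩
    rw [h.iterate_odd (by omega), Nat.cast_sub c6]
    push_cast; ring

theorem periodicPtOfPeriod_natCast (h : IsStefanLike k f) {t : ℕ}
    (ht : t ∈ Set.Icc 1 (2 * k + 1)) : PeriodicPtOfPeriod f (2 * k + 1) t := by
  obtain ⟨-, -, -, -, -, -, -, -, hper⟩ := h.iterate_tail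
  obtain ⟨n, hn⟩ := h.exists_iterate_eq ht
  have hper : Function.IsPeriodicPt f (2 * k + 1) ((k : ℝ) + 1) := hper
  rw [← hn]
  refine ⟨hper.apply_iterate n, fun j hj hj' hjn => h.iterate_ne hj hj' ?_⟩
  have hmem : (k : ℝ) + 1 ∈ Function.periodicPts f :=
    Function.mk_mem_periodicPts (by omega) hper
  have h1 : Function.IsPeriodicPt f j (f^[n] (k + 1)) := hjn
  rw [Function.isPeriodicPt_iff_minimalPeriod_dvd, Function.minimalPeriod_apply_iterate hmem,
    ← Function.isPeriodicPt_iff_minimalPeriod_dvd] at h1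
  exact h1

theorem exists_period (h : IsStefanLike k f) :
    ∃ y ∈ Set.Icc (1 : ℝ) (2 * k + 1), PeriodicPtOfPeriod f (2 * k - 1) y := by
  have hk := h.four_le_cast
  have hk4 := h.four_le
  obtain ⟨-, -, -, -, -, -, h4, -, -⟩ := h.iterate_tail
  have hend : f^[2 * k - 1] (k + 9 / 8) = k + 1 := by
    obtain ⟨m, hm⟩ : ∃ m, m + 4 = k := ⟨k - 4, by omega⟩
    have hm' : (m : ℝ) = k - 4 := by rw [← hm]; push_cast; ring
    have e2 : f^[2] (k + 9 / 8) = k + 1 / 2 := by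
      change f (f _) = _
      rw [h.center (k + 9 / 8) (by linarith) (by linarith),
        h.center _ (by linarith) (by linarith)]
      ring
    have e3 : f^[2 * m] (k + 1 / 2) = 9 / 2 := by
      rw [h.iterate_two_mul_eq_sub (by linarith) m (by linarith), hm']
      ring
    have e4 : f (9 / 2) = 2 * k - 3 / 2 := by
      rw [h.midLeft _ (by norm_num) (by linarith)]; ring
    rw [show 2 * k - 1 = 5 + (2 * m + 2) by omega, Function.iterate_add_apply,
      Function.iterate_add_apply _ (2 * m), e2, e3]
    change f (f (f (f (f (9 / 2))))) = _
    rw [e4, h.map_map_middle, h.map_two_mul, h.map_one]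
  have hcont : Continuous fun y => f^[2 * k - 1] y - y :=
    (h.continuous.iterate _).sub continuous_id
  obtain ⟨y, ⟨hy1, hy2⟩, hy⟩ := intermediate_value_Icc' (by linarith : (k : ℝ) + 1 ≤ k + 9 / 8)
    hcont.continuousOn (show (0 : ℝ) ∈ Set.Icc _ _ from
      ⟨by simp only [hend]; linarith, by simp only [h4]; linarith⟩)
  have hyI : y ∈ Set.Icc (1 : ℝ) (2 * k + 1) := ⟨by linarith, by linarith⟩
  have hyp : Function.IsPeriodicPt f (2 * k - 1) y := sub_eq_zero.1 hy
  refine ⟨y, hyI, hyp, fun j hj hj' hjy => ?_⟩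
  have hdvd := hyp.minimalPeriod_dvd
  have hle : Function.minimalPeriod f y ≤ j :=
    Function.IsPeriodicPt.minimalPeriod_le hj hjy
  have hodd : Odd (Function.minimalPeriod f y) :=
    Odd.of_dvd_nat ⟨k - 1, by omega⟩ hdvd
  have := h.fixed_of_odd_return hodd (by omega) hyI (Function.iterate_minimalPeriod)
  rw [h.center y hy1 (by linarith)] at this
  linarith

theorem realizedSM (h : IsStefanLike k f) {σ : ℕ → ℕ}
    (hσ : ∀ t ∈ Set.Icc 1 (2 * k + 1), f t = σ t) : RealizedSM k σ := by
  have hcast : ∀ {t : ℕ}, (t : ℝ) ∈ Set.Icc (1 : ℝ) (2 * k + 1) ↔ t ∈ Set.Icc 1 (2 * k + 1) := by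
    intro t
    simp only [Set.mem_Icc]
    norm_cast
  have hmaps : Set.MapsTo σ (Set.Icc 1 (2 * k + 1)) (Set.Icc 1 (2 * k + 1)) := fun t ht => by
    rw [← hcast, ← hσ t ht]
    exact h.mapsTo (hcast.2 ht)
  have hinj : Set.InjOn σ (Set.Icc 1 (2 * k + 1)) := fun s hs t ht hst => by
    have hfst : f s = f t := by rw [hσ s hs, hσ t ht, hst]
    have h1 := (h.periodicPtOfPeriod_natCast hs).1
    have h2 := (h.periodicPtOfPeriod_natCast ht).1
    rw [Function.iterate_succ_apply, hfst, ← Function.iterate_succ_apply, h2] at h1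
    exact_mod_cast h1.symm
  have hbij : Set.BijOn σ (Set.Icc 1 (2 * k + 1)) (Set.Icc 1 (2 * k + 1)) :=
    ((Set.finite_Icc _ _).injOn_iff_bijOn_of_mapsTo hmaps).1 hinj
  refine ⟨f, fun t => t, h.continuous, ⟨fun _ _ _ _ hst => Nat.cast_lt.2 hst,
    fun t ht => h.periodicPtOfPeriod_natCast ht, hbij, hσ⟩, ?_, ?_⟩
  · obtain ⟨y, hyI, hy⟩ := h.exists_period
    exact ⟨y, hy, fun j => by simpa using h.iterate_mem hyI j⟩
  · rintro q hq hq1 hqk ⟨y, hy, hyI⟩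
    have hyI : y ∈ Set.Icc (1 : ℝ) (2 * k + 1) := by simpa using hyI 0
    exact hy.2 1 le_rfl hq1 (h.fixed_of_odd_return hq hqk hyI hy.1)

end IsStefanLike

/-- The piecewise linear interpolation of the first permutation. -/
noncomputable def interpSwap (k : ℕ) (x : ℝ) : ℝ :=
  k + 1 + (k - 1) * (x - 1) - (k - 2) * max (x - 2) 0 - 3 * max (x - 3) 0 + max (x - 4) 0 -
    max (x - (k + 1)) 0 + max (x - (k + 2)) 0 - max (x - (2 * k - 1)) 0 + 3 * max (x - 2 * k) 0

/-- The piecewise linear interpolation of the second permutation. -/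
noncomputable def interpCycle (k : ℕ) (x : ℝ) : ℝ :=
  k + 1 + k * (x - 1) - (k + 1) * max (x - 2) 0 - max (x - (k + 1)) 0 + max (x - (k + 2)) 0 -
    max (x - (2 * k - 2)) 0 + max (x - (2 * k - 1)) 0 + 3 * max (x - 2 * k) 0

theorem max_sub_zero_of_le {a x : ℝ} (h : a ≤ x) : max (x - a) 0 = x - a :=
  max_eq_left (sub_nonneg.2 h)

theorem max_sub_zero_of_ge {a x : ℝ} (h : x ≤ a) : max (x - a) 0 = 0 :=
  max_eq_right (sub_nonpos.2 h)

theorem isStefanLike_interpSwap {k : ℕ} (hk : 4 ≤ k) : IsStefanLike k (interpSwap k) := by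
  have hk' : (4 : ℝ) ≤ k := by exact_mod_cast hk
  have hright : ∀ x : ℝ, 2 * k - 2 ≤ x → x ≤ 2 * k - 1 → interpSwap k x = 2 * k + 2 - x := by
    intro x h1 h2
    unfold interpSwap
    simp (disch := grind) only [max_sub_zero_of_le, max_sub_zero_of_ge]
    ring
  have hthree : ∀ x : ℝ, 3 ≤ x → x ≤ 4 → interpSwap k x = 2 * k + 7 - 2 * x := by
    intro x h1 h2
    unfold interpSwap
    simp (disch := grind) only [max_sub_zero_of_le, max_sub_zero_of_ge]
    ring
  have htwo : ∀ x : ℝ, 2 ≤ x → x ≤ 3 → interpSwap k x = 2 * k - 2 + x := by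
    intro x h1 h2
    unfold interpSwap
    simp (disch := grind) only [max_sub_zero_of_le, max_sub_zero_of_ge]
    ring
  have hpenult : ∀ x : ℝ, 2 * k - 1 ≤ x → x ≤ 2 * k → interpSwap k x = 4 * k + 1 - 2 * x := by
    intro x h1 h2
    unfold interpSwap
    simp (disch := grind) only [max_sub_zero_of_le, max_sub_zero_of_ge]
    ring
  have hlast : ∀ x : ℝ, 2 * k ≤ x → interpSwap k x = x + 1 - 2 * k := by
    intro x h1
    unfold interpSwap
    simp (disch := grind) only [max_sub_zero_of_le]
    ring
  have hfirst : ∀ x : ℝ, x ≤ 2 → interpSwap k x = k + 1 + (k - 1) * (x - 1) := by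
    intro x h1
    unfold interpSwap
    simp (disch := grind) only [max_sub_zero_of_ge]
    ring
  refine ⟨by unfold interpSwap; fun_prop, hk, fun x h1 h2 => ?_, fun x h1 h2 => ?_,
    fun x h1 h2 => ?_, fun x h1 h2 => ?_, fun x h1 h2 => ?_, fun x h1 h2 => ?_,
    fun x h1 h2 => ?_, ?_, ?_, ?_, 3, 2, Or.inr ⟨rfl, rfl⟩, ?_, ?_, ?_, ?_⟩
  · rw [hfirst x h2]
    constructor <;> nlinarith
  · rcases le_total x 3 with h3 | h3
    · rw [htwo x h1 h3]
      constructor <;> linarith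
    · rw [hthree x h3 h2]
      constructor <;> linarith
  · unfold interpSwap
    simp (disch := grind) only [max_sub_zero_of_le, max_sub_zero_of_ge]
    ring
  · unfold interpSwap
    simp (disch := grind) only [max_sub_zero_of_le, max_sub_zero_of_ge]
    ring
  · unfold interpSwap
    simp (disch := grind) only [max_sub_zero_of_le, max_sub_zero_of_ge]
    ring
  · rw [hright x h1 h2]
    constructor <;> linarith
  · rcases le_total x (2 * k) with h3 | h3
    · rw [hpenult x h1 h3]
      constructor <;> linarith
    · rw [hlast x h3]
      constructor <;> linarith
  · rw [hright (2 * k - 3 / 2) (by linarith) (by linarith),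
      hthree _ (by linarith) (by linarith)]
    ring
  · rw [hlast _ le_rfl]; ring
  · rw [hfirst _ (by norm_num)]; ring
  · rw [hright _ (by linarith) le_rfl]; ring
  · rw [hthree _ le_rfl (by norm_num)]; ring
  · rw [hlast _ (by linarith)]; ring
  · rw [htwo _ le_rfl (by norm_num)]; ring

theorem isStefanLike_interpCycle {k : ℕ} (hk : 4 ≤ k) : IsStefanLike k (interpCycle k) := by
  have hk' : (4 : ℝ) ≤ k := by exact_mod_cast hk
  have hfirst : ∀ x : ℝ, x ≤ 2 → interpCycle k x = k + 1 + k * (x - 1) := by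
    intro x h1
    unfold interpCycle
    simp (disch := grind) only [max_sub_zero_of_ge]
    ring
  have hleft : ∀ x : ℝ, 2 ≤ x → x ≤ k + 1 → interpCycle k x = 2 * k + 3 - x := by
    intro x h1 h2
    unfold interpCycle
    simp (disch := grind) only [max_sub_zero_of_le, max_sub_zero_of_ge]
    ring
  have hright : ∀ x : ℝ, 2 * k - 2 ≤ x → x ≤ 2 * k - 1 → interpCycle k x = 4 * k - 2 * x := by
    intro x h1 h2
    unfold interpCycle
    simp (disch := grind) only [max_sub_zero_of_le, max_sub_zero_of_ge]
    ring
  have hpenult : ∀ x : ℝ, 2 * k - 1 ≤ x → x ≤ 2 * k → interpCycle k x = 2 * k + 1 - x := by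
    intro x h1 h2
    unfold interpCycle
    simp (disch := grind) only [max_sub_zero_of_le, max_sub_zero_of_ge]
    ring
  have hlast : ∀ x : ℝ, 2 * k ≤ x → interpCycle k x = 2 * x + 1 - 4 * k := by
    intro x h1
    unfold interpCycle
    simp (disch := grind) only [max_sub_zero_of_le]
    ring
  refine ⟨by unfold interpCycle; fun_prop, hk, fun x h1 h2 => ?_, fun x h1 h2 => ?_,
    fun x h1 h2 => hleft x (by linarith) h2, fun x h1 h2 => ?_, fun x h1 h2 => ?_,
    fun x h1 h2 => ?_, fun x h1 h2 => ?_, ?_, ?_, ?_, 2, 3, Or.inl ⟨rfl, rfl⟩, ?_, ?_, ?_, ?_⟩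
  · rw [hfirst x h2]
    constructor <;> nlinarith
  · rw [hleft x h1 (by linarith)]
    constructor <;> linarith
  · unfold interpCycle
    simp (disch := grind) only [max_sub_zero_of_le, max_sub_zero_of_ge]
    ring
  · unfold interpCycle
    simp (disch := grind) only [max_sub_zero_of_le, max_sub_zero_of_ge]
    ring
  · rw [hright x h1 h2]
    constructor <;> linarith
  · rcases le_total x (2 * k) with h3 | h3
    · rw [hpenult x h1 h3]
      constructor <;> linarith
    · rw [hlast x h3]
      constructor <;> linarith
  · rw [hright (2 * k - 3 / 2) (by linarith) (by linarith),
      hleft _ (by linarith) (by linarith)]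
    ring
  · rw [hlast _ le_rfl]; ring
  · rw [hfirst _ (by norm_num)]; ring
  · rw [hright _ (by linarith) le_rfl]; ring
  · rw [hleft _ le_rfl (by linarith)]; ring
  · rw [hlast _ (by linarith)]; ring
  · rw [hleft _ (by norm_num) (by linarith)]; ring

/-- Two second minimal permutations arising from setting `(2, 2k−1)`. -/
theorem realized_setting_2_2km1 (k : ℕ) (hk : 4 ≤ k) :
    RealizedSM k (fun t =>
      if t = 2 then 2*k else if t = 3 then 2*k+1 else if t = 2*k then 1
      else if t = 2*k+1 then 2 else stefanPerm k t) ∧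
    RealizedSM k (fun t =>
      if t = 2*k-1 then 2 else if t = 2*k then 1 else if t = 2*k+1 then 3
      else stefanPerm k t) := by
  have hk' : (4 : ℝ) ≤ k := by exact_mod_cast hk
  constructor
  · refine (isStefanLike_interpSwap hk).realizedSM fun t ht => ?_
    obtain ⟨ht1, ht2⟩ := ht
    unfold stefanPerm
    split_ifs with c1 c2 c3 c4 c5 c6
    · subst c1; push_cast
      unfold interpSwap
      simp (disch := grind) only [max_sub_zero_of_le, max_sub_zero_of_ge]
      ring
    · subst c2; push_cast
      unfold interpSwap
      simp (disch := grind) only [max_sub_zero_of_le, max_sub_zero_of_ge]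
      ring
    · subst c3; push_cast
      unfold interpSwap
      simp (disch := grind) only [max_sub_zero_of_le]
      ring
    · subst c4; push_cast
      unfold interpSwap
      simp (disch := grind) only [max_sub_zero_of_le]
      ring
    · subst c5; push_cast
      unfold interpSwap
      simp (disch := grind) only [max_sub_zero_of_ge]
      ring
    · have h1 : (4 : ℝ) ≤ t := by exact_mod_cast (by omega : 4 ≤ t)
      have h2 : (t : ℝ) ≤ k + 1 := by exact_mod_cast (by omega : t ≤ k + 1)
      rw [Nat.cast_sub (by omega)]
      push_cast
      unfold interpSwap
      simp (disch := grind) only [max_sub_zero_of_le, max_sub_zero_of_ge]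
      ring
    · have h1 : (k : ℝ) + 2 ≤ t := by exact_mod_cast (by omega : k + 2 ≤ t)
      have h2 : (t : ℝ) + 1 ≤ 2 * k := by exact_mod_cast (by omega : t + 1 ≤ 2 * k)
      rw [Nat.cast_sub (by omega)]
      push_cast
      unfold interpSwap
      simp (disch := grind) only [max_sub_zero_of_le, max_sub_zero_of_ge]
      ring
  · refine (isStefanLike_interpCycle hk).realizedSM fun t ht => ?_
    obtain ⟨ht1, ht2⟩ := ht
    unfold stefanPerm
    split_ifs with c1 c2 c3 c4 c5
    · rw [c1, Nat.cast_sub (by omega)]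
      push_cast
      unfold interpCycle
      simp (disch := grind) only [max_sub_zero_of_le, max_sub_zero_of_ge]
      ring
    · subst c2; push_cast
      unfold interpCycle
      simp (disch := grind) only [max_sub_zero_of_le]
      ring
    · subst c3; push_cast
      unfold interpCycle
      simp (disch := grind) only [max_sub_zero_of_le]
      ring
    · subst c4; push_cast
      unfold interpCycle
      simp (disch := grind) only [max_sub_zero_of_ge]
      ring
    · have h1 : (2 : ℝ) ≤ t := by exact_mod_cast (by omega : 2 ≤ t)
      have h2 : (t : ℝ) ≤ k + 1 := by exact_mod_cast (by omega : t ≤ k + 1)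
      rw [Nat.cast_sub (by omega)]
      push_cast
      unfold interpCycle
      simp (disch := grind) only [max_sub_zero_of_le, max_sub_zero_of_ge]
      ring
    · have h1 : (k : ℝ) + 2 ≤ t := by exact_mod_cast (by omega : k + 2 ≤ t)
      have h2 : (t : ℝ) + 2 ≤ 2 * k := by exact_mod_cast (by omega : t + 2 ≤ 2 * k)
      rw [Nat.cast_sub (by omega)]
      push_cast
      unfold interpCycle
      simp (disch := grind) only [max_sub_zero_of_le, max_sub_zero_of_ge]
      ring
end

section
/- Let k ≥ 4, let i be an integer with 2 < i < k, and set j = 2k − i. Each of the following four permutations π of {1,…,2k+1} is realized by a second minimal (2k+1)-orbit of some continuous map f : ℝ → ℝ: (a) π agrees with the Stefan permutation π_S except π(i−1) = j+2, π(i) = j+4, π(i+1) = j+3; (b) π agrees with π_S except π(i) = j+2, π(i+1) = j+3, π(j+1) = i, π(j+2) = i+1; (c) π agrees with π_S except π(i) = j+2, π(i+1) = j+3, π(j+2) = i−1, π(j+3) = i; (d) π agrees with π_S except π(i) = j+1, π(i+1) = j+3, π(i+2) = j+2. -/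
/-- Piecewise affine interpolation, constant outside `[1, n + 1]`, of the values `v 1, …, v (n + 1)`
at the nodes `1, …, n + 1`. -/
noncomputable def affineInterp (v : ℕ → ℕ) : ℕ → ℝ → ℝ
  | 0, _ => v 1
  | n + 1, x => affineInterp v n x + ((v (n + 2) : ℝ) - v (n + 1)) * max 0 (min 1 (x - (n + 1)))

section affineInterp

variable {v : ℕ → ℕ} {n : ℕ}

theorem continuous_affineInterp (v : ℕ → ℕ) (n : ℕ) : Continuous (affineInterp v n) := by
  induction n with
  | zero => exact continuous_const
  | succ n ih =>
    change Continuous fun x => affineInterp v n x +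
      ((v (n + 2) : ℝ) - v (n + 1)) * max 0 (min 1 (x - (n + 1)))
    fun_prop

theorem affineInterp_of_le {x : ℝ} (hx : (n : ℝ) + 1 ≤ x) : affineInterp v n x = v (n + 1) := by
  induction n with
  | zero => rfl
  | succ n ih =>
    push_cast at hx
    have h : max 0 (min 1 (x - ((n : ℝ) + 1))) = 1 := by
      rw [min_eq_left (by linarith), max_eq_right zero_le_one]
    simp only [affineInterp, ih (by linarith), h]
    ring

theorem affineInterp_of_mem {s : ℕ} {x : ℝ} (hs : 1 ≤ s) (hsn : s ≤ n) (hx : (s : ℝ) ≤ x)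
    (hx' : x ≤ s + 1) :
    affineInterp v n x = v s + (x - s) * ((v (s + 1) : ℝ) - v s) := by
  induction n with
  | zero => omega
  | succ n ih =>
    rcases hsn.lt_or_eq with h | rfl
    · have hc : (s : ℝ) ≤ n := by exact_mod_cast Nat.lt_succ_iff.mp h
      have h0 : max 0 (min 1 (x - ((n : ℝ) + 1))) = 0 :=
        max_eq_left ((min_le_right _ _).trans (by linarith))
      simp only [affineInterp, ih (by omega), h0]
      ring
    · push_cast at hx hx' ⊢
      have h1 : max 0 (min 1 (x - ((n : ℝ) + 1))) = x - (n + 1) := by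
        rw [min_eq_right (by linarith), max_eq_right (by linarith)]
      simp only [affineInterp, affineInterp_of_le hx, h1]
      ring

theorem affineInterp_natCast {s : ℕ} (hs : 1 ≤ s) (hsn : s ≤ n + 1) :
    affineInterp v n s = v s := by
  rcases hsn.lt_or_eq with h | rfl
  · rw [affineInterp_of_mem hs (by omega) le_rfl (by linarith)]
    ring
  · exact affineInterp_of_le (by push_cast; rfl)

theorem exists_affineInterp_eq {a b : ℕ} (ha : 1 ≤ a) (hab : a < b) (hb : b ≤ n + 1) {x : ℝ}
    (hx : (a : ℝ) ≤ x) (hx' : x ≤ b) :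
    ∃ s, a ≤ s ∧ s + 1 ≤ b ∧ ∃ θ : ℝ, 0 ≤ θ ∧ θ ≤ 1 ∧
      affineInterp v n x = (1 - θ) * v s + θ * v (s + 1) := by
  induction b, hab using Nat.le_induction with
  | base =>
    push_cast at hx'
    refine ⟨a, le_rfl, le_rfl, x - a, by linarith, by linarith, ?_⟩
    rw [affineInterp_of_mem ha (by omega) hx hx']
    ring
  | succ b hab ih =>
    rcases le_total x b with h | h
    · obtain ⟨s, h1, h2, h3⟩ := ih (by omega) h
      exact ⟨s, h1, by omega, h3⟩
    · push_cast at hx'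
      refine ⟨b, by omega, le_rfl, x - b, by linarith, by linarith, ?_⟩
      rw [affineInterp_of_mem (by omega) (by omega) h hx']
      ring

theorem affineInterp_le {a b M : ℕ} (ha : 1 ≤ a) (hab : a < b) (hb : b ≤ n + 1)
    (hM : ∀ s, a ≤ s → s ≤ b → v s ≤ M) {x : ℝ} (hx : (a : ℝ) ≤ x) (hx' : x ≤ b) :
    affineInterp v n x ≤ M := by
  obtain ⟨s, h1, h2, θ, h3, h4, h5⟩ := exists_affineInterp_eq (v := v) ha hab hb hx hx'
  have e1 : (v s : ℝ) ≤ M := by exact_mod_cast hM s h1 (by omega)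
  have e2 : (v (s + 1) : ℝ) ≤ M := by exact_mod_cast hM (s + 1) (by omega) h2
  nlinarith

theorem le_affineInterp {a b M : ℕ} (ha : 1 ≤ a) (hab : a < b) (hb : b ≤ n + 1)
    (hM : ∀ s, a ≤ s → s ≤ b → M ≤ v s) {x : ℝ} (hx : (a : ℝ) ≤ x) (hx' : x ≤ b) :
    (M : ℝ) ≤ affineInterp v n x := by
  obtain ⟨s, h1, h2, θ, h3, h4, h5⟩ := exists_affineInterp_eq (v := v) ha hab hb hx hx'
  have e1 : (M : ℝ) ≤ v s := by exact_mod_cast hM s h1 (by omega)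
  have e2 : (M : ℝ) ≤ v (s + 1) := by exact_mod_cast hM (s + 1) (by omega) h2
  nlinarith

theorem iterate_affineInterp_natCast (hv : Set.MapsTo v (Set.Icc 1 (n + 1)) (Set.Icc 1 (n + 1)))
    {t : ℕ} (ht : t ∈ Set.Icc 1 (n + 1)) (m : ℕ) :
    (affineInterp v n)^[m] t = (v^[m] t : ℕ) := by
  induction m with
  | zero => rfl
  | succ m ih =>
    have h := hv.iterate m ht
    rw [Function.iterate_succ_apply', Function.iterate_succ_apply', ih,
      affineInterp_natCast h.1 h.2]

end affineInterp

section CyclicRank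

variable {N : ℕ} {v r : ℕ → ℕ} {S : Set ℕ}

theorem rank_iterate_modEq (hv : Set.MapsTo v S S)
    (hr : ∀ t ∈ S, r (v t) ≡ r t + 1 [MOD N]) {t : ℕ} (ht : t ∈ S) (m : ℕ) :
    r (v^[m] t) ≡ r t + m [MOD N] := by
  induction m with
  | zero => rfl
  | succ m ih =>
    rw [Function.iterate_succ_apply']
    exact (hr _ (hv.iterate m ht)).trans (ih.add_right 1)

theorem iterate_eq_iff_dvd_of_rank (hv : Set.MapsTo v S S) (hlt : ∀ t ∈ S, r t < N)
    (hinj : Set.InjOn r S) (hr : ∀ t ∈ S, r (v t) ≡ r t + 1 [MOD N]) {t : ℕ} (ht : t ∈ S) (m : ℕ) :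
    v^[m] t = t ↔ N ∣ m := by
  have h := rank_iterate_modEq hv hr ht m
  constructor
  · intro e
    rw [e] at h
    exact (Nat.modEq_zero_iff_dvd).1 (Nat.ModEq.add_left_cancel' (r t) (h.symm.trans rfl))
  · intro d
    refine hinj (hv.iterate m ht) ht (Nat.ModEq.eq_of_lt_of_lt (h.trans ?_)
      (hlt _ (hv.iterate m ht)) (hlt t ht))
    exact ((Nat.modEq_zero_iff_dvd).2 d).add_left (r t)

theorem bijOn_of_rank (hS : S.Finite) (hv : Set.MapsTo v S S) (hlt : ∀ t ∈ S, r t < N)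
    (hinj : Set.InjOn r S) (hr : ∀ t ∈ S, r (v t) ≡ r t + 1 [MOD N]) : Set.BijOn v S S := by
  have hi : Set.InjOn v S := by
    intro s hs t ht e
    refine hinj hs ht (Nat.ModEq.eq_of_lt_of_lt ?_ (hlt s hs) (hlt t ht))
    have h := (hr s hs).symm
    rw [e] at h
    exact Nat.ModEq.add_right_cancel' 1 (h.trans (hr t ht))
  refine ⟨hv, hi, ?_⟩
  have h := Set.eq_of_subset_of_ncard_le hv.image_subset (hi.ncard_image).ge hS
  exact h.ge

end CyclicRank

theorem isOrbitWithPerm_affineInterp {n : ℕ} {v r : ℕ → ℕ}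
    (hv : Set.MapsTo v (Set.Icc 1 (n + 1)) (Set.Icc 1 (n + 1)))
    (hlt : ∀ t ∈ Set.Icc 1 (n + 1), r t < n + 1) (hinj : Set.InjOn r (Set.Icc 1 (n + 1)))
    (hr : ∀ t ∈ Set.Icc 1 (n + 1), r (v t) ≡ r t + 1 [MOD n + 1]) :
    IsOrbitWithPerm (affineInterp v n) (n + 1) (fun t => (t : ℝ)) v := by
  refine ⟨Nat.strictMono_cast.strictMonoOn _, fun t ht => ⟨?_, fun m hm hm' => ?_⟩,
    bijOn_of_rank (Set.finite_Icc _ _) hv hlt hinj hr, fun t ht => affineInterp_natCast ht.1 ht.2⟩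
  · rw [iterate_affineInterp_natCast hv ht,
      (iterate_eq_iff_dvd_of_rank hv hlt hinj hr ht _).2 dvd_rfl]
  · rw [iterate_affineInterp_natCast hv ht, Ne, Nat.cast_inj,
      iterate_eq_iff_dvd_of_rank hv hlt hinj hr ht]
    exact Nat.not_dvd_of_pos_of_lt hm hm'

/-- Combinatorial data forcing the first `k - 2` images of `[k + 1, c]` under the second iterate of
the interpolation of `v` (`c` the central fixed point) to be exactly `[lo m, c]`. -/
structure CentralSpread (k : ℕ) (v lo hi : ℕ → ℕ) : Prop where
  mapsTo : Set.MapsTo v (Set.Icc 1 (2 * k + 1)) (Set.Icc 1 (2 * k + 1))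
  one : v 1 = k + 1
  last : v (2 * k + 1) = 1
  left : ∀ s, 2 ≤ s → s ≤ k + 1 → k + 2 ≤ v s
  right : ∀ s, k + 2 ≤ s → s ≤ 2 * k + 1 → v s ≤ k + 1
  lo_zero : lo 0 = k + 1
  hi_last : hi (k - 2) = 2 * k + 1
  two_le_lo : ∀ m ≤ k - 2, 2 ≤ lo m
  lo_le : ∀ m ≤ k - 2, lo m ≤ k + 1
  le_hi : ∀ m ≤ k - 2, k + 2 ≤ hi m
  hi_le : ∀ m ≤ k - 2, hi m ≤ 2 * k + 1
  le_hi_of_lo_le : ∀ m ≤ k - 2, ∀ s, lo m ≤ s → s ≤ k + 1 → v s ≤ hi m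
  exists_hi_le : ∀ m ≤ k - 2, ∃ s, lo m ≤ s ∧ s ≤ k + 1 ∧ hi m ≤ v s
  lo_le_of_le_hi : ∀ m < k - 2, ∀ s, k + 2 ≤ s → s ≤ hi m → lo (m + 1) ≤ v s
  exists_le_lo : ∀ m < k - 2, ∃ s, k + 2 ≤ s ∧ s ≤ hi m ∧ v s ≤ lo (m + 1)

namespace CentralSpread

variable {k : ℕ} {v lo hi : ℕ → ℕ}

theorem exists_center (h : CentralSpread k v lo hi) (hk : 2 ≤ k) :
    ∃ c : ℝ, (k : ℝ) + 1 ≤ c ∧ c ≤ k + 2 ∧ affineInterp v (2 * k) c = c ∧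
      (∀ x, (k : ℝ) + 1 ≤ x → x ≤ c → c ≤ affineInterp v (2 * k) x) ∧
      ∀ x, c ≤ x → x ≤ (k : ℝ) + 2 → affineInterp v (2 * k) x ≤ c := by
  have e1 : (k : ℝ) + 2 ≤ v (k + 1) := by exact_mod_cast h.left (k + 1) (by omega) le_rfl
  have e2 : (v (k + 2) : ℝ) ≤ k + 1 := by exact_mod_cast h.right (k + 2) le_rfl (by omega)
  have hf : ∀ x : ℝ, (k : ℝ) + 1 ≤ x → x ≤ k + 2 → affineInterp v (2 * k) x =
      v (k + 1) + (x - (k + 1)) * ((v (k + 2) : ℝ) - v (k + 1)) := by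
    intro x h1 h2
    rw [affineInterp_of_mem (s := k + 1) (by omega) (by omega) (by push_cast; exact h1)
      (by push_cast; linarith)]
    push_cast
    rfl
  have hcont : ContinuousOn (fun x => x - affineInterp v (2 * k) x)
      (Set.Icc ((k : ℝ) + 1) (k + 2)) :=
    (continuous_id.sub (continuous_affineInterp v (2 * k))).continuousOn
  obtain ⟨c, ⟨hc1, hc2⟩, hc⟩ := intermediate_value_Icc (by linarith) hcont
    (show (0 : ℝ) ∈ _ by
      constructor
      · rw [hf _ le_rfl (by linarith)]; linarith
      · rw [hf _ (by linarith) le_rfl]; linarith)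
  have hfc : affineInterp v (2 * k) c = c := by simp only at hc; linarith
  refine ⟨c, hc1, hc2, hfc, fun x h1 h2 => ?_, fun x h1 h2 => ?_⟩
  · have := hf x h1 (h2.trans hc2)
    have := hf c hc1 hc2
    nlinarith
  · have := hf x (hc1.trans h1) h2
    have := hf c hc1 hc2
    nlinarith

theorem mapsTo_affineInterp (h : CentralSpread k v lo hi) (hk : 1 ≤ k) :
    Set.MapsTo (affineInterp v (2 * k)) (Set.Icc 1 (2 * k + 1)) (Set.Icc 1 (2 * k + 1)) := by
  intro x hx
  constructor
  · have := le_affineInterp (n := 2 * k) (M := 1) (a := 1) (b := 2 * k + 1) le_rfl (by omega)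
      le_rfl (fun s h1 h2 => (h.mapsTo ⟨h1, h2⟩).1) (by simpa using hx.1) (by push_cast; exact hx.2)
    simpa using this
  · have := affineInterp_le (n := 2 * k) (M := 2 * k + 1) (a := 1) (b := 2 * k + 1) le_rfl (by omega)
      le_rfl (fun s h1 h2 => (h.mapsTo ⟨h1, h2⟩).2) (by simpa using hx.1)
      (by push_cast; exact hx.2)
    exact_mod_cast this

section center

variable {c : ℝ} (hc1 : (k : ℝ) + 1 ≤ c) (hc2 : c ≤ k + 2) (hfc : affineInterp v (2 * k) c = c)
  (hl : ∀ x, (k : ℝ) + 1 ≤ x → x ≤ c → c ≤ affineInterp v (2 * k) x)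
  (hr : ∀ x, c ≤ x → x ≤ (k : ℝ) + 2 → affineInterp v (2 * k) x ≤ c)

include hc2 hl in
theorem center_le (h : CentralSpread k v lo hi) (hk : 2 ≤ k) {x : ℝ} (hx : 2 ≤ x) (hx' : x ≤ c) :
    c ≤ affineInterp v (2 * k) x := by
  rcases le_total x (k + 1) with h1 | h1
  · have := le_affineInterp (n := 2 * k) (M := k + 2) (a := 2) (b := k + 1) (by omega) (by omega)
      (by omega) h.left (by exact_mod_cast hx) (by push_cast; exact h1)
    push_cast at this
    linarith
  · exact hl x h1 hx'

include hc1 hr in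
theorem le_center (h : CentralSpread k v lo hi) (hk : 2 ≤ k) {x : ℝ} (hx : c ≤ x)
    (hx' : x ≤ 2 * k + 1) : affineInterp v (2 * k) x ≤ c := by
  rcases le_total (k + 2 : ℝ) x with h1 | h1
  · have := affineInterp_le (n := 2 * k) (M := k + 1) (a := k + 2) (b := 2 * k + 1) (by omega)
      (by omega) (by omega) h.right (by push_cast; exact h1) (by push_cast; exact hx')
    push_cast at this
    linarith
  · exact hr x hx h1

include hc2 in
theorem affineInterp_le_hi (h : CentralSpread k v lo hi) (hk : 2 ≤ k) {m : ℕ} (hm : m ≤ k - 2)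
    {x : ℝ} (hx : lo m ≤ x) (hx' : x ≤ c) : affineInterp v (2 * k) x ≤ hi m := by
  have h1 := h.two_le_lo m hm
  have h2 := h.lo_le m hm
  refine affineInterp_le (a := lo m) (b := k + 2) (by omega) (by omega) (by omega)
    (fun s hs hs' => ?_) hx (by push_cast; linarith)
  rcases hs'.lt_or_eq with h3 | rfl
  · exact h.le_hi_of_lo_le m hm s hs (by omega)
  · have := h.right (k + 2) le_rfl (by omega)
    have := h.le_hi m hm
    omega

include hc1 in
theorem lo_le_affineInterp (h : CentralSpread k v lo hi) (hk : 2 ≤ k) {m : ℕ} (hm : m < k - 2)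
    {x : ℝ} (hx : c ≤ x) (hx' : x ≤ hi m) : lo (m + 1) ≤ affineInterp v (2 * k) x := by
  have h1 := h.le_hi m hm.le
  have h2 := h.hi_le m hm.le
  refine le_affineInterp (a := k + 1) (b := hi m) (by omega) (by omega) (by omega)
    (fun s hs hs' => ?_) (by push_cast; linarith) hx'
  rcases hs.lt_or_eq with h3 | rfl
  · exact h.lo_le_of_le_hi m hm s (by omega) hs'
  · have := h.left (k + 1) (by omega) le_rfl
    have := h.lo_le (m + 1) (by omega)
    omega

include hc1 hc2 hl hr in
theorem iterate_mem (h : CentralSpread k v lo hi) (hk : 2 ≤ k) {x : ℝ} (hx : (k : ℝ) + 1 ≤ x)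
    (hx' : x ≤ c) {m : ℕ} (hm : m ≤ k - 2) :
    (affineInterp v (2 * k))^[2 * m] x ∈ Set.Icc (lo m : ℝ) c := by
  induction m with
  | zero => simpa [h.lo_zero] using ⟨hx, hx'⟩
  | succ m ih =>
    obtain ⟨h1, h2⟩ := ih (by omega)
    have h0 : (2 : ℝ) ≤ lo m := by exact_mod_cast h.two_le_lo m (by omega)
    have h3 := h.center_le hc2 hl hk (h0.trans h1) h2
    have h4 := h.affineInterp_le_hi hc2 hk (by omega) h1 h2
    have h5 : (hi m : ℝ) ≤ 2 * k + 1 := by exact_mod_cast h.hi_le m (by omega)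
    rw [show 2 * (m + 1) = 2 * m + 1 + 1 by ring, Function.iterate_succ_apply',
      Function.iterate_succ_apply']
    exact ⟨h.lo_le_affineInterp hc1 hk (by omega) h3 h4, h.le_center hc1 hr hk h3 (h4.trans h5)⟩

include hc1 hfc in
theorem exists_left_preimage (h : CentralSpread k v lo hi) {m : ℕ} (hm : m ≤ k - 2)
    {w : ℝ} (hw : c ≤ w) (hw' : w ≤ hi m) :
    ∃ u, (lo m : ℝ) ≤ u ∧ u ≤ c ∧ affineInterp v (2 * k) u = w := by
  obtain ⟨s, h1, h2, h3⟩ := h.exists_hi_le m hm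
  have h0 := h.two_le_lo m hm
  have e1 : (lo m : ℝ) ≤ s := by exact_mod_cast h1
  have e2 : (s : ℝ) ≤ k + 1 := by exact_mod_cast h2
  have e3 : (hi m : ℝ) ≤ v s := by exact_mod_cast h3
  obtain ⟨u, ⟨hu, hu'⟩, huw⟩ := intermediate_value_Icc' (e2.trans hc1)
    (continuous_affineInterp v (2 * k)).continuousOn
    (show w ∈ _ by
      rw [hfc, affineInterp_natCast (by omega) (by omega)]
      exact ⟨hw, hw'.trans e3⟩)
  exact ⟨u, e1.trans hu, hu', huw⟩

include hc2 hfc in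
theorem exists_right_preimage {s : ℕ}
    (hs : k + 2 ≤ s) (hs' : s ≤ 2 * k + 1) {y : ℝ} (hy : v s ≤ y) (hy' : y ≤ c) :
    ∃ w, c ≤ w ∧ w ≤ s ∧ affineInterp v (2 * k) w = y := by
  have e1 : (k : ℝ) + 2 ≤ s := by exact_mod_cast hs
  obtain ⟨w, ⟨hw, hw'⟩, hwy⟩ := intermediate_value_Icc' (hc2.trans e1)
    (continuous_affineInterp v (2 * k)).continuousOn
    (show y ∈ _ by
      rw [hfc, affineInterp_natCast (by omega) (by omega)]
      exact ⟨hy, hy'⟩)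
  exact ⟨w, hw, hw', hwy⟩

include hc1 hc2 hfc in
theorem exists_iterate_eq (h : CentralSpread k v lo hi) {m : ℕ} (hm : m ≤ k - 2)
    {y : ℝ} (hy : lo m ≤ y) (hy' : y ≤ c) :
    ∃ z, (k : ℝ) + 1 ≤ z ∧ z ≤ c ∧ (affineInterp v (2 * k))^[2 * m] z = y := by
  induction m generalizing y with
  | zero => exact ⟨y, by simpa [h.lo_zero] using hy, hy', rfl⟩
  | succ m ih =>
    obtain ⟨s, h1, h2, h3⟩ := h.exists_le_lo m (by omega)
    have e2 : (s : ℝ) ≤ hi m := by exact_mod_cast h2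
    have e3 : (v s : ℝ) ≤ lo (m + 1) := by exact_mod_cast h3
    obtain ⟨w, hw, hw', hwy⟩ := exists_right_preimage hc2 hfc h1
      (h2.trans (h.hi_le m (by omega))) (e3.trans hy) hy'
    obtain ⟨u, hu, hu', huw⟩ := h.exists_left_preimage hc1 hfc (by omega) hw (hw'.trans e2)
    obtain ⟨z, hz, hz', hzu⟩ := ih (by omega) hu hu'
    refine ⟨z, hz, hz', ?_⟩
    rw [show 2 * (m + 1) = 2 * m + 1 + 1 by ring, Function.iterate_succ_apply',
      Function.iterate_succ_apply', hzu, huw, hwy]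

include hc1 hc2 hfc in
theorem exists_iterate_eq_self (h : CentralSpread k v lo hi) (hk : 2 ≤ k) :
    ∃ x : ℝ, 1 ≤ x ∧ x ≤ 2 ∧ (affineInterp v (2 * k))^[2 * k - 1] x = x := by
  have hk' : (2 : ℝ) ≤ k := by exact_mod_cast hk
  obtain ⟨w, hw, hw', hw1⟩ := exists_right_preimage hc2 hfc (s := 2 * k + 1) (by omega) le_rfl
    (y := 1) (by rw [h.last]; simp) (by linarith)
  obtain ⟨u, hu, hu', huw⟩ := h.exists_left_preimage hc1 hfc (m := k - 2) le_rfl hw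
    (by rwa [h.hi_last])
  obtain ⟨z, hz, hz', hzu⟩ := h.exists_iterate_eq hc1 hc2 hfc le_rfl hu hu'
  have h2 : (k : ℝ) + 2 ≤ v 2 := by exact_mod_cast h.left 2 le_rfl (by omega)
  have f1 : affineInterp v (2 * k) 1 = v 1 := by
    simpa using affineInterp_natCast (v := v) (n := 2 * k) (s := 1) le_rfl (by omega)
  have f2 : affineInterp v (2 * k) 2 = v 2 := by
    simpa using affineInterp_natCast (v := v) (n := 2 * k) (s := 2) (by omega) (by omega)
  have hcont := continuous_affineInterp v (2 * k)
  obtain ⟨p, ⟨hp, hp'⟩, hpz⟩ := intermediate_value_Icc (one_le_two (α := ℝ)) hcont.continuousOn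
    (show z ∈ _ by
      rw [f1, f2, h.one]
      push_cast
      exact ⟨hz, by linarith⟩)
  have hgp : (affineInterp v (2 * k))^[2 * k - 1] p = 1 := by
    rw [show 2 * k - 1 = 2 * (k - 2) + 1 + 1 + 1 by omega, Function.iterate_succ_apply, hpz,
      Function.iterate_succ_apply', Function.iterate_succ_apply', hzu, huw, hw1]
  have hg1 : 1 ≤ (affineInterp v (2 * k))^[2 * k - 1] 1 :=
    ((h.mapsTo_affineInterp (by omega)).iterate _ ⟨le_rfl, by linarith⟩).1
  obtain ⟨x, ⟨hx, hx'⟩, hx0⟩ := intermediate_value_Icc' hp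
    ((hcont.iterate (2 * k - 1)).sub continuous_id).continuousOn
    (show (0 : ℝ) ∈ _ by
      simp only [Pi.sub_apply, id, hgp]
      exact ⟨by linarith, by linarith⟩)
  exact ⟨x, hx, hx'.trans hp', sub_eq_zero.1 hx0⟩

include hc1 hc2 hl hr in
theorem eq_center_of_iterate_eq_self (h : CentralSpread k v lo hi) (hk : 2 ≤ k) {q : ℕ}
    (hq : Odd q) (hqk : q < 2 * k - 1) {y : ℝ}
    (hy : (affineInterp v (2 * k))^[q] y = y)
    (hmem : ∀ n, (affineInterp v (2 * k))^[n] y ∈ Set.Icc (1 : ℝ) (2 * k + 1)) : y = c := by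
  by_cases hbad : ∃ n, (affineInterp v (2 * k))^[n] y ≤ 2 ∧ (affineInterp v (2 * k))^[n + 1] y < c
  · exfalso
    obtain ⟨n, hn, hn'⟩ := hbad
    rw [Function.iterate_succ_apply'] at hn'
    set x := (affineInterp v (2 * k))^[n] y with hx
    have hxq : (affineInterp v (2 * k))^[q] x = x := by
      rw [hx, ← Function.iterate_add_apply, add_comm, Function.iterate_add_apply, hy]
    have hle : (k : ℝ) + 1 ≤ affineInterp v (2 * k) x := by
      have := le_affineInterp (v := v) (n := 2 * k) (M := k + 1) (a := 1) (b := 2) le_rfl (by omega)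
        (by omega) (fun s h1 h2 => ?_) (x := x) (by simpa using (hmem n).1) (by exact_mod_cast hn)
      · exact_mod_cast this
      · rcases h2.lt_or_eq with h3 | rfl
        · rw [show s = 1 by omega, h.one]
        · exact (Nat.le_succ _).trans (h.left 2 le_rfl (by omega))
    obtain ⟨m, rfl⟩ := hq
    have := h.iterate_mem hc1 hc2 hl hr hk hle hn'.le (m := m) (by omega)
    rw [← Function.iterate_succ_apply, Nat.succ_eq_add_one, hxq] at this
    have h2 : (2 : ℝ) ≤ lo m := by exact_mod_cast h.two_le_lo m (by omega)
    exact absurd (h.center_le hc2 hl hk (h2.trans this.1) this.2) (not_le.2 hn')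
  · push Not at hbad
    have step : ∀ n, (affineInterp v (2 * k))^[n] y ≤ c →
        c ≤ (affineInterp v (2 * k))^[n + 1] y := by
      intro n hn
      rcases le_total ((affineInterp v (2 * k))^[n] y) 2 with h1 | h1
      · exact hbad n h1
      · rw [Function.iterate_succ_apply']
        exact h.center_le hc2 hl hk h1 hn
    have step' : ∀ n, c ≤ (affineInterp v (2 * k))^[n] y →
        (affineInterp v (2 * k))^[n + 1] y ≤ c := by
      intro n hn
      rw [Function.iterate_succ_apply']
      exact h.le_center hc1 hr hk hn (hmem n).2
    obtain ⟨m, rfl⟩ := hq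
    rcases le_total y c with h1 | h1
    · have : ∀ m, (affineInterp v (2 * k))^[2 * m] y ≤ c := by
        intro m
        induction m with
        | zero => exact h1
        | succ m ih => exact step' _ (step _ ih)
      exact le_antisymm h1 ((step _ (this m)).trans_eq hy)
    · have : ∀ m, c ≤ (affineInterp v (2 * k))^[2 * m] y := by
        intro m
        induction m with
        | zero => exact h1
        | succ m ih => exact step _ (step' _ ih)
      exact le_antisymm (hy.symm.trans_le (step' _ (this m))) h1

end center

theorem secondMinimalOrbit (h : CentralSpread k v lo hi) (hk : 2 ≤ k) :
    SecondMinimalOrbit (affineInterp v (2 * k)) k (fun t => (t : ℝ)) := by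
  have hk' : (2 : ℝ) ≤ k := by exact_mod_cast hk
  obtain ⟨c, hc1, hc2, hfc, hl, hr⟩ := h.exists_center hk
  simp only [SecondMinimalOrbit, Nat.cast_one, Nat.cast_add, Nat.cast_mul, Nat.cast_ofNat]
  constructor
  · obtain ⟨x, hx, hx', hxx⟩ := h.exists_iterate_eq_self hc1 hc2 hfc hk
    have hmem : ∀ n, (affineInterp v (2 * k))^[n] x ∈ Set.Icc (1 : ℝ) (2 * k + 1) := fun n =>
      (h.mapsTo_affineInterp (by omega)).iterate n ⟨hx, by linarith⟩
    refine ⟨x, ⟨hxx, fun m hm hm' hxm => ?_⟩, hmem⟩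
    have hgcd : (affineInterp v (2 * k))^[m.gcd (2 * k - 1)] x = x :=
      Function.IsPeriodicPt.gcd (f := affineInterp v (2 * k)) hxm hxx
    have hodd : Odd (m.gcd (2 * k - 1)) :=
      Odd.of_dvd_nat ⟨k - 1, by omega⟩ (Nat.gcd_dvd_right m (2 * k - 1))
    have hxc := h.eq_center_of_iterate_eq_self hc1 hc2 hl hr hk hodd
      ((Nat.gcd_le_left _ hm).trans_lt hm') hgcd hmem
    linarith
  · rintro q hq hq1 hqk ⟨y, ⟨hy, hmin⟩, hmem⟩
    have hyc := h.eq_center_of_iterate_eq_self hc1 hc2 hl hr hk hq hqk hy hmem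
    exact hmin 1 le_rfl hq1 (by rw [hyc]; exact hfc)

theorem realizedSM {r : ℕ → ℕ} (h : CentralSpread k v lo hi) (hk : 2 ≤ k)
    (hlt : ∀ t ∈ Set.Icc 1 (2 * k + 1), r t < 2 * k + 1)
    (hinj : Set.InjOn r (Set.Icc 1 (2 * k + 1)))
    (hr : ∀ t ∈ Set.Icc 1 (2 * k + 1), r (v t) = if r t = 2 * k then 0 else r t + 1) :
    RealizedSM k v := by
  refine ⟨affineInterp v (2 * k), fun t => t, continuous_affineInterp v _,
    isOrbitWithPerm_affineInterp h.mapsTo hlt hinj fun t ht => ?_, h.secondMinimalOrbit hk⟩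
  rw [hr t ht]
  split_ifs with e
  · rw [e]
    exact (Nat.modEq_zero_iff_dvd.2 dvd_rfl).symm
  · rfl

end CentralSpread

/-- The position of `t` in the Stefan cycle started at `1`. -/
def stefanRank (k t : ℕ) : ℕ :=
  if t = 1 then 0 else if t ≤ k + 1 then 2 * k + 3 - 2 * t else 2 * t - 2 * k - 2

theorem stefanRank_lt {k t : ℕ} (ht : t ∈ Set.Icc 1 (2 * k + 1)) : stefanRank k t < 2 * k + 1 := by
  obtain ⟨h1, h2⟩ := ht
  unfold stefanRank
  split_ifs <;> omega

theorem stefanRank_injOn (k : ℕ) : Set.InjOn (stefanRank k) (Set.Icc 1 (2 * k + 1)) := by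
  rintro s ⟨hs, hs'⟩ t ⟨ht, ht'⟩ h
  unfold stefanRank at h
  split_ifs at h <;> omega

theorem CentralSpread.realizedSM_of_conj {k : ℕ} {v lo hi τ : ℕ → ℕ} (h : CentralSpread k v lo hi)
    (hk : 2 ≤ k) (hτ : Set.MapsTo τ (Set.Icc 1 (2 * k + 1)) (Set.Icc 1 (2 * k + 1)))
    (hinv : ∀ t, τ (τ t) = t) (hconj : ∀ t ∈ Set.Icc 1 (2 * k + 1), τ (v t) = stefanPerm k (τ t)) :
    RealizedSM k v := by
  refine h.realizedSM (r := fun t => stefanRank k (τ t)) hk (fun t ht => stefanRank_lt (hτ ht))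
    ((stefanRank_injOn k).comp (Function.LeftInverse.injective hinv).injOn hτ) fun t ht => ?_
  obtain ⟨h1, h2⟩ := hτ ht
  simp only [hconj t ht]
  generalize τ t = s at *
  unfold stefanRank stefanPerm
  split_ifs <;> omega

/-- The values `k + 1, k, …, 2` with `s` left out. -/
def skipDescent (k s m : ℕ) : ℕ := if m + s ≤ k then k + 1 - m else k - m

theorem realizedSM_left_upper {k i j : ℕ} (hij : i + j = 2 * k) (hi1 : 2 < i) (hi2 : i < k) :
    RealizedSM k (fun t => if t = i - 1 then j + 2 else if t = i then j + 4
      else if t = i + 1 then j + 3 else stefanPerm k t) := by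
  refine CentralSpread.realizedSM_of_conj (lo := skipDescent k i)
    (hi := fun m => if m + i < k then m + k + 2 else m + k + 3)
    (τ := fun t => if t = i then i - 1 else if t = i - 1 then i
      else if t = j + 2 then j + 3 else if t = j + 3 then j + 2 else t)
    ⟨?_, ?_, ?_, ?_, ?_, ?_, ?_, ?_, ?_, ?_, ?_, ?_, ?_, ?_, ?_⟩ (by omega) ?_ ?_ ?_
  · rintro t ⟨h1, h2⟩
    simp only [stefanPerm, Set.mem_Icc]
    grind
  · grind [stefanPerm]
  · grind [stefanPerm]
  · grind [stefanPerm]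
  · grind [stefanPerm]
  · grind [skipDescent]
  · grind [skipDescent]
  · grind [skipDescent]
  · grind [skipDescent]
  · grind [skipDescent]
  · grind [skipDescent]
  · grind [skipDescent, stefanPerm]
  · intro m hm
    refine ⟨if skipDescent k i m = i - 1 then i else skipDescent k i m, ?_⟩
    grind [skipDescent, stefanPerm]
  · grind [skipDescent, stefanPerm]
  · intro m hm
    refine ⟨if m + i < k then m + k + 2 else m + k + 3, ?_⟩
    grind (splits := 20) [skipDescent, stefanPerm]
  · rintro t ⟨h1, h2⟩
    simp only [Set.mem_Icc]
    grind
  · grind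
  · rintro t ⟨h1, h2⟩
    grind (splits := 20) [stefanPerm]

theorem realizedSM_left_swap {k i j : ℕ} (hij : i + j = 2 * k) (hi1 : 2 < i) (hi2 : i < k) :
    RealizedSM k (fun t => if t = i then j + 2 else if t = i + 1 then j + 3 else if t = j + 1 then i
      else if t = j + 2 then i + 1 else stefanPerm k t) := by
  refine CentralSpread.realizedSM_of_conj (lo := skipDescent k (i + 1))
    (hi := fun m => if m + i + 1 ≤ k then m + k + 2 else m + k + 3)
    (τ := fun t => if t = i then i + 1 else if t = i + 1 then i else t)
    ⟨?_, ?_, ?_, ?_, ?_, ?_, ?_, ?_, ?_, ?_, ?_, ?_, ?_, ?_, ?_⟩ (by omega) ?_ ?_ ?_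
  · rintro t ⟨h1, h2⟩
    simp only [stefanPerm, Set.mem_Icc]
    grind
  · grind [stefanPerm]
  · grind [stefanPerm]
  · grind [stefanPerm]
  · grind [stefanPerm]
  · grind [skipDescent]
  · grind [skipDescent]
  · grind [skipDescent]
  · grind [skipDescent]
  · grind [skipDescent]
  · grind [skipDescent]
  · grind [skipDescent, stefanPerm]
  · intro m hm
    refine ⟨if skipDescent k (i + 1) m = i then i + 1 else skipDescent k (i + 1) m, ?_⟩
    grind [skipDescent, stefanPerm]
  · grind [skipDescent, stefanPerm]
  · intro m hm
    refine ⟨if m + i + 1 ≤ k then m + k + 2 else m + k + 3, ?_⟩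
    grind (splits := 20) [skipDescent, stefanPerm]
  · rintro t ⟨h1, h2⟩
    simp only [Set.mem_Icc]
    grind
  · grind
  · rintro t ⟨h1, h2⟩
    grind (splits := 20) [stefanPerm]

theorem realizedSM_right_swap {k i j : ℕ} (hij : i + j = 2 * k) (hi1 : 2 < i) (hi2 : i < k) :
    RealizedSM k (fun t => if t = i then j + 2 else if t = i + 1 then j + 3 else if t = j + 2 then i - 1
      else if t = j + 3 then i else stefanPerm k t) := by
  refine CentralSpread.realizedSM_of_conj (lo := skipDescent k i)
    (hi := fun m => if m + i < k then m + k + 2 else m + k + 3)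
    (τ := fun t => if t = j + 2 then j + 3 else if t = j + 3 then j + 2 else t)
    ⟨?_, ?_, ?_, ?_, ?_, ?_, ?_, ?_, ?_, ?_, ?_, ?_, ?_, ?_, ?_⟩ (by omega) ?_ ?_ ?_
  · rintro t ⟨h1, h2⟩
    simp only [stefanPerm, Set.mem_Icc]
    grind
  · grind [stefanPerm]
  · grind [stefanPerm]
  · grind [stefanPerm]
  · grind [stefanPerm]
  · grind [skipDescent]
  · grind [skipDescent]
  · grind [skipDescent]
  · grind [skipDescent]
  · grind [skipDescent]
  · grind [skipDescent]
  · grind [skipDescent, stefanPerm]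
  · intro m hm
    refine ⟨skipDescent k i m, ?_⟩
    grind [skipDescent, stefanPerm]
  · grind [skipDescent, stefanPerm]
  · intro m hm
    refine ⟨if m + i = k then j + 2 else if m + i < k then m + k + 2 else m + k + 3, ?_⟩
    grind (splits := 20) [skipDescent, stefanPerm]
  · rintro t ⟨h1, h2⟩
    simp only [Set.mem_Icc]
    grind
  · grind
  · rintro t ⟨h1, h2⟩
    grind (splits := 20) [stefanPerm]

theorem realizedSM_left_lower {k i j : ℕ} (hij : i + j = 2 * k) (hi1 : 2 < i) (hi2 : i < k) :
    RealizedSM k (fun t => if t = i then j + 1 else if t = i + 1 then j + 3 else if t = i + 2 then j + 2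
      else stefanPerm k t) := by
  refine CentralSpread.realizedSM_of_conj (lo := skipDescent k (i + 1))
    (hi := fun m => if m + i + 1 < k then m + k + 2 else m + k + 3)
    (τ := fun t => if t = i then i + 1 else if t = i + 1 then i
      else if t = j + 1 then j + 2 else if t = j + 2 then j + 1 else t)
    ⟨?_, ?_, ?_, ?_, ?_, ?_, ?_, ?_, ?_, ?_, ?_, ?_, ?_, ?_, ?_⟩ (by omega) ?_ ?_ ?_
  · rintro t ⟨h1, h2⟩
    simp only [stefanPerm, Set.mem_Icc]
    grind
  · grind [stefanPerm]
  · grind [stefanPerm]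
  · grind [stefanPerm]
  · grind [stefanPerm]
  · grind [skipDescent]
  · grind [skipDescent]
  · grind [skipDescent]
  · grind [skipDescent]
  · grind [skipDescent]
  · grind [skipDescent]
  · grind [skipDescent, stefanPerm]
  · intro m hm
    refine ⟨if skipDescent k (i + 1) m = i then i + 1 else skipDescent k (i + 1) m, ?_⟩
    grind [skipDescent, stefanPerm]
  · grind [skipDescent, stefanPerm]
  · intro m hm
    refine ⟨if m + i + 1 < k then m + k + 2 else m + k + 3, ?_⟩
    grind (splits := 20) [skipDescent, stefanPerm]
  · rintro t ⟨h1, h2⟩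
    simp only [Set.mem_Icc]
    grind
  · grind
  · rintro t ⟨h1, h2⟩
    grind (splits := 20) [stefanPerm]

/-- The four second minimal permutations arising from setting `(i, 2k−i)`,
`2 < i < k`, with `j = 2k − i`. -/
theorem realized_setting_i_j (k i : ℕ) (hk : 4 ≤ k) (hi1 : 2 < i)
    (hi2 : i < k) :
    RealizedSM k (fun t =>
      if t = i-1 then (2*k-i)+2 else if t = i then (2*k-i)+4
      else if t = i+1 then (2*k-i)+3 else stefanPerm k t) ∧
    RealizedSM k (fun t =>
      if t = i then (2*k-i)+2 else if t = i+1 then (2*k-i)+3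
      else if t = (2*k-i)+1 then i else if t = (2*k-i)+2 then i+1
      else stefanPerm k t) ∧
    RealizedSM k (fun t =>
      if t = i then (2*k-i)+2 else if t = i+1 then (2*k-i)+3
      else if t = (2*k-i)+2 then i-1 else if t = (2*k-i)+3 then i
      else stefanPerm k t) ∧
    RealizedSM k (fun t =>
      if t = i then (2*k-i)+1 else if t = i+1 then (2*k-i)+3
      else if t = i+2 then (2*k-i)+2 else stefanPerm k t) := by
  have hij : i + (2 * k - i) = 2 * k := by omega
  exact ⟨realizedSM_left_upper hij hi1 hi2, realizedSM_left_swap hij hi1 hi2,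
    realizedSM_right_swap hij hi1 hi2, realizedSM_left_lower hij hi1 hi2⟩
end

section
/- Let k ≥ 4, let i be an integer with 2 < i < k, and set j = 2k − i. Each of the following four permutations π of {1,…,2k+1} is realized by a second minimal (2k+1)-orbit of some continuous map f : ℝ → ℝ: (a) π agrees with the Stefan permutation π_S except π(i−1) = j+3, π(i) = j+4, π(j+2) = i−1, π(j+3) = i; (b) π agrees with π_S except π(i) = j+2, π(i+1) = j+3, π(j+2) = i−1, π(j+3) = i; (c) π agrees with π_S except π(j+1) = i, π(j+2) = i−1, π(j+3) = i+1; (d) π agrees with π_S except π(j+2) = i−1, π(j+3) = i−2, π(j+4) = i. -/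
open Function

/-- The map interpolating the values `F 0, …, F N` linearly at the nodes `0, …, N`,
constant outside `[0, N]`. -/
noncomputable def linearInterp (F : ℕ → ℝ) (N : ℕ) (x : ℝ) : ℝ :=
  F 0 + ∑ t ∈ Finset.range N, (F (t + 1) - F t) * max 0 (min 1 (x - t))

theorem continuous_linearInterp (F : ℕ → ℝ) (N : ℕ) : Continuous (linearInterp F N) := by
  unfold linearInterp
  fun_prop

theorem linearInterp_of_mem (F : ℕ → ℝ) {N s : ℕ} (hs : s < N) {x : ℝ} (h0 : (s : ℝ) ≤ x)
    (h1 : x ≤ s + 1) : linearInterp F N x = F s + (F (s + 1) - F s) * (x - s) := by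
  obtain ⟨m, rfl⟩ : ∃ m, N = s + 1 + m := ⟨N - (s + 1), by omega⟩
  unfold linearInterp
  rw [Finset.sum_range_add, Finset.sum_range_succ]
  have hleft : ∑ t ∈ Finset.range s, (F (t + 1) - F t) * max 0 (min 1 (x - t)) = F s - F 0 := by
    rw [← Finset.sum_range_sub]
    refine Finset.sum_congr rfl fun t ht => ?_
    have : (t : ℝ) + 1 ≤ s := by exact_mod_cast Finset.mem_range.mp ht
    rw [min_eq_left (by linarith), max_eq_right zero_le_one, mul_one]
  have hright : ∑ t ∈ Finset.range m, (F (s + 1 + t + 1) - F (s + 1 + t)) *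
      max 0 (min 1 (x - ((s + 1 + t : ℕ) : ℝ))) = 0 := by
    refine Finset.sum_eq_zero fun t _ => ?_
    have : x - ((s + 1 + t : ℕ) : ℝ) ≤ 0 := by
      push_cast
      linarith [(Nat.cast_nonneg t : (0 : ℝ) ≤ t)]
    rw [max_eq_left ((min_le_right _ _).trans this), mul_zero]
  rw [hleft, hright, min_eq_right (by linarith), max_eq_right (by linarith)]
  ring

theorem linearInterp_natCast (F : ℕ → ℝ) {N s : ℕ} (hs : s ≤ N) :
    linearInterp F N s = F s := by
  rcases hs.lt_or_eq with h | rfl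
  · simp [linearInterp_of_mem F h le_rfl (by linarith)]
  · rcases s with _ | n
    · simp [linearInterp]
    · rw [linearInterp_of_mem F n.lt_succ_self (by push_cast; linarith) (by push_cast; rfl)]
      push_cast
      ring

theorem linearInterp_mem_uIcc (F : ℕ → ℝ) {N s : ℕ} (hs : s < N) {x : ℝ} (h0 : (s : ℝ) ≤ x)
    (h1 : x ≤ s + 1) : linearInterp F N x ∈ Set.uIcc (F s) (F (s + 1)) := by
  rw [linearInterp_of_mem F hs h0 h1, Set.mem_uIcc]
  rcases le_total (F s) (F (s + 1)) with h | h
  · left; constructor <;> nlinarith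
  · right; constructor <;> nlinarith

/-- A closed walk whose levels rise by at most one at each step, and where every step that does
not change the parity of the level falls by at least `M - 1`, is of even length or of length
at least `M`. -/
theorem le_of_odd_closed_walk {H : ℕ → ℤ} {M : ℤ} {q : ℕ}
    (hstep : ∀ n, H (n + 1) ≤ H n + 1 ∧
      ((H (n + 1) - H n) % 2 = 1 ∨ H (n + 1) + M ≤ H n + 1))
    (hclosed : H q = H 0) (hq : Odd q) : M ≤ q := by
  have key : ∀ n : ℕ, H n ≤ H 0 + n ∧ ((H n - H 0 - n) % 2 = 0 ∨ H n + M ≤ H 0 + n) := by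
    intro n
    induction n with
    | zero => simp
    | succ n ih =>
      have := hstep n
      push_cast
      omega
  have := key q
  obtain ⟨r, rfl⟩ := hq
  push_cast at this ⊢
  omega

/-- The order embedding of `{1, …, 2k+1}` into `{1, …, 2k+2}` omitting `k + 2`. -/
def skipCenter (k t : ℕ) : ℕ := if t ≤ k + 1 then t else t + 1

/-- The self-map of `{1, …, 2k+2}` acting as `π` on the image of `skipCenter k` and fixing the
remaining point `k + 2`. -/
def addFixedPoint (k : ℕ) (π : ℕ → ℕ) (t : ℕ) : ℕ :=
  if t ≤ k + 1 then skipCenter k (π t) else if t = k + 2 then k + 2 else skipCenter k (π (t - 1))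

theorem skipCenter_strictMono (k : ℕ) : StrictMono (skipCenter k) := by
  intro a b h
  unfold skipCenter
  split_ifs <;> omega

theorem addFixedPoint_skipCenter (k : ℕ) (π : ℕ → ℕ) (t : ℕ) :
    addFixedPoint k π (skipCenter k t) = skipCenter k (π t) := by
  unfold addFixedPoint
  by_cases h : t ≤ k + 1
  · simp [skipCenter, h]
  · have h1 : skipCenter k t = t + 1 := by simp [skipCenter, h]
    rw [h1, if_neg (by omega), if_neg (by omega), Nat.add_sub_cancel]

theorem eq_center_or_exists_skipCenter {k s : ℕ} (hs : s ∈ Set.Icc 1 (2 * k + 2)) :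
    s = k + 2 ∨ ∃ t ∈ Set.Icc 1 (2 * k + 1), skipCenter k t = s := by
  obtain ⟨h1, h2⟩ := hs
  rcases lt_trichotomy s (k + 2) with h | h | h
  · exact .inr ⟨s, ⟨h1, by omega⟩, if_pos (by omega)⟩
  · exact .inl h
  · refine .inr ⟨s - 1, ⟨by omega, by omega⟩, ?_⟩
    rw [skipCenter, if_neg (by omega)]
    omega

theorem skipCenter_mem {k t : ℕ} (ht : t ∈ Set.Icc 1 (2 * k + 1)) :
    skipCenter k t ∈ Set.Icc 1 (2 * k + 2) := by
  obtain ⟨h1, h2⟩ := ht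
  simp only [skipCenter, Set.mem_Icc]
  split_ifs <;> omega

theorem addFixedPoint_mem {k : ℕ} {π : ℕ → ℕ}
    (hπ : Set.MapsTo π (Set.Icc 1 (2 * k + 1)) (Set.Icc 1 (2 * k + 1))) {s : ℕ}
    (hs : s ∈ Set.Icc 1 (2 * k + 2)) : addFixedPoint k π s ∈ Set.Icc 1 (2 * k + 2) := by
  rcases eq_center_or_exists_skipCenter hs with rfl | ⟨t, ht, rfl⟩
  · simpa [addFixedPoint] using hs
  · rw [addFixedPoint_skipCenter]
    exact skipCenter_mem (hπ ht)

/-- `ℓ` labels `{1, …, m}` injectively by residues modulo `m` in such a way that `π` increases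
the label by one; thus `π` is an `m`-cycle. -/
structure IsCycleLabel (m : ℕ) (π ℓ : ℕ → ℕ) : Prop where
  mapsTo : Set.MapsTo π (Set.Icc 1 m) (Set.Icc 1 m)
  label_lt : ∀ t ∈ Set.Icc 1 m, ℓ t < m
  injOn : Set.InjOn ℓ (Set.Icc 1 m)
  label_apply : ∀ t ∈ Set.Icc 1 m, ℓ (π t) = ℓ t + 1 ∨ ℓ t + 1 = m ∧ ℓ (π t) = 0

namespace IsCycleLabel

variable {m : ℕ} {π ℓ : ℕ → ℕ}

theorem label_iterate (h : IsCycleLabel m π ℓ) {t : ℕ} (ht : t ∈ Set.Icc 1 m) (n : ℕ) :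
    ℓ (π^[n] t) ≡ ℓ t + n [MOD m] := by
  induction n with
  | zero => rfl
  | succ n ih =>
    rw [iterate_succ_apply']
    have hstep : ℓ (π (π^[n] t)) ≡ ℓ (π^[n] t) + 1 [MOD m] := by
      rcases h.label_apply _ (h.mapsTo.iterate n ht) with h1 | ⟨h1, h2⟩
      · rw [h1]
      · rw [h1, h2]
        simp [Nat.ModEq]
    exact hstep.trans (ih.add_right 1)

theorem iterate_eq_self_iff (h : IsCycleLabel m π ℓ) {t : ℕ} (ht : t ∈ Set.Icc 1 m) (n : ℕ) :
    π^[n] t = t ↔ m ∣ n := by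
  have hl := h.label_iterate ht n
  constructor
  · intro he
    rw [he] at hl
    exact (Nat.modEq_zero_iff_dvd).mp (Nat.ModEq.add_left_cancel' (ℓ t) hl.symm)
  · intro hd
    refine h.injOn (h.mapsTo.iterate n ht) ht ?_
    have : ℓ (π^[n] t) ≡ ℓ t [MOD m] :=
      hl.trans (by simpa using (Nat.modEq_zero_iff_dvd.mpr hd).add_left (ℓ t))
    exact this.eq_of_lt_of_lt (h.label_lt _ (h.mapsTo.iterate n ht)) (h.label_lt _ ht)

theorem bijOn (h : IsCycleLabel m π ℓ) : Set.BijOn π (Set.Icc 1 m) (Set.Icc 1 m) := by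
  have hfix : ∀ t ∈ Set.Icc 1 m, π^[m - 1] (π t) = t := by
    intro t ht
    have hm : m - 1 + 1 = m := by
      have := ht.1.trans ht.2
      omega
    rw [← iterate_succ_apply, Nat.succ_eq_add_one, hm]
    exact (h.iterate_eq_self_iff ht m).mpr dvd_rfl
  refine Set.InvOn.bijOn (f' := π^[m - 1]) ⟨hfix, fun t ht => ?_⟩ h.mapsTo
    (h.mapsTo.iterate _)
  have := hfix t ht
  rwa [← iterate_succ_apply, iterate_succ_apply'] at this

end IsCycleLabel

theorem periodicPtOfPeriod_iff {f : ℝ → ℝ} {n : ℕ} (hn : 0 < n) {x : ℝ} :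
    PeriodicPtOfPeriod f n x ↔ minimalPeriod f x = n := by
  constructor
  · rintro ⟨h1, h2⟩
    refine le_antisymm (IsPeriodicPt.minimalPeriod_le hn h1) (not_lt.mp fun hlt => ?_)
    exact h2 _ (IsPeriodicPt.minimalPeriod_pos hn h1) hlt (iterate_minimalPeriod)
  · rintro rfl
    exact ⟨iterate_minimalPeriod, fun j hj hlt =>
      not_isPeriodicPt_of_pos_of_lt_minimalPeriod (by omega) hlt⟩

section Realization

variable {k : ℕ} {π ℓ : ℕ → ℕ}

/-- The piecewise linear map with nodes `1, …, 2k+2` inducing `addFixedPoint k π` on them. -/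
noncomputable def cycleMap (k : ℕ) (π : ℕ → ℕ) : ℝ → ℝ :=
  linearInterp (fun t => (addFixedPoint k π t : ℝ)) (2 * k + 2)

theorem cycleMap_natCast {s : ℕ} (hs : s ≤ 2 * k + 2) :
    cycleMap k π s = addFixedPoint k π s :=
  linearInterp_natCast _ hs

theorem cycleMap_skipCenter {t : ℕ} (ht : t ∈ Set.Icc 1 (2 * k + 1)) :
    cycleMap k π (skipCenter k t) = skipCenter k (π t) := by
  rw [cycleMap_natCast (skipCenter_mem ht).2, addFixedPoint_skipCenter]

theorem iterate_cycleMap_skipCenter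
    (hπ : Set.MapsTo π (Set.Icc 1 (2 * k + 1)) (Set.Icc 1 (2 * k + 1))) {t : ℕ}
    (ht : t ∈ Set.Icc 1 (2 * k + 1)) (n : ℕ) :
    (cycleMap k π)^[n] (skipCenter k t) = skipCenter k (π^[n] t) := by
  induction n with
  | zero => rfl
  | succ n ih =>
    rw [iterate_succ_apply', ih, cycleMap_skipCenter (hπ.iterate n ht), iterate_succ_apply']

theorem isPeriodicPt_skipCenter_iff (h : IsCycleLabel (2 * k + 1) π ℓ) {t : ℕ}
    (ht : t ∈ Set.Icc 1 (2 * k + 1)) (n : ℕ) :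
    IsPeriodicPt (cycleMap k π) n (skipCenter k t) ↔ 2 * k + 1 ∣ n := by
  rw [IsPeriodicPt, IsFixedPt, iterate_cycleMap_skipCenter h.mapsTo ht, Nat.cast_inj,
    (skipCenter_strictMono k).injective.eq_iff, h.iterate_eq_self_iff ht]

theorem minimalPeriod_skipCenter (h : IsCycleLabel (2 * k + 1) π ℓ) {t : ℕ}
    (ht : t ∈ Set.Icc 1 (2 * k + 1)) :
    minimalPeriod (cycleMap k π) (skipCenter k t) = 2 * k + 1 :=
  Nat.dvd_antisymm
    (((isPeriodicPt_skipCenter_iff h ht _).mpr dvd_rfl).minimalPeriod_dvd)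
    ((isPeriodicPt_skipCenter_iff h ht _).mp (isPeriodicPt_minimalPeriod _ _))

theorem isFixedPt_center (k : ℕ) (π : ℕ → ℕ) :
    IsFixedPt (cycleMap k π) ((k + 2 : ℕ) : ℝ) := by
  rw [IsFixedPt, cycleMap_natCast (by omega)]
  simp [addFixedPoint]

theorem floor_mem {x : ℝ} (hx : x ∈ Set.Icc (1 : ℝ) ((2 * k + 2 : ℕ) : ℝ)) :
    ⌊x⌋₊ ∈ Set.Icc 1 (2 * k + 2) :=
  ⟨Nat.le_floor (by exact_mod_cast hx.1), Nat.floor_le_of_le hx.2⟩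

theorem floor_lt_of_ne {x : ℝ} (hx : x ∈ Set.Icc (1 : ℝ) ((2 * k + 2 : ℕ) : ℝ))
    (hne : ∀ s : ℕ, x ≠ s) : ⌊x⌋₊ < 2 * k + 2 :=
  (Nat.floor_lt (by linarith [hx.1])).mpr (lt_of_le_of_ne hx.2 (hne _))

theorem mapsTo_cycleMap
    (hπ : Set.MapsTo π (Set.Icc 1 (2 * k + 1)) (Set.Icc 1 (2 * k + 1))) :
    Set.MapsTo (cycleMap k π) (Set.Icc (1 : ℝ) ((2 * k + 2 : ℕ) : ℝ))
      (Set.Icc (1 : ℝ) ((2 * k + 2 : ℕ) : ℝ)) := by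
  intro x hx
  have hcast : ∀ s ∈ Set.Icc 1 (2 * k + 2),
      (addFixedPoint k π s : ℝ) ∈ Set.Icc (1 : ℝ) ((2 * k + 2 : ℕ) : ℝ) := fun s hs =>
    ⟨by exact_mod_cast (addFixedPoint_mem hπ hs).1, by exact_mod_cast (addFixedPoint_mem hπ hs).2⟩
  by_cases hne : ∀ s : ℕ, x ≠ s
  · have hlt := floor_lt_of_ne hx hne
    have h1 := (floor_mem hx).1
    exact Set.uIcc_subset_Icc (hcast _ (floor_mem hx)) (hcast _ ⟨by omega, by omega⟩)
      (linearInterp_mem_uIcc (fun t => (addFixedPoint k π t : ℝ)) hlt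
        (Nat.floor_le (by linarith [hx.1])) (Nat.lt_floor_add_one x).le)
  · push Not at hne
    obtain ⟨s, rfl⟩ := hne
    have hs : s ∈ Set.Icc 1 (2 * k + 2) :=
      ⟨by exact_mod_cast hx.1, by exact_mod_cast hx.2⟩
    rw [cycleMap_natCast hs.2]
    exact hcast s hs

/-- `u` is the left endpoint of a unit interval covered by the image of `[s, s + 1]` under
`cycleMap k π`. -/
def Covers (k : ℕ) (π : ℕ → ℕ) (s u : ℕ) : Prop :=
  addFixedPoint k π s ≤ u ∧ u < addFixedPoint k π (s + 1) ∨
    addFixedPoint k π (s + 1) ≤ u ∧ u < addFixedPoint k π s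

theorem covers_floor_cycleMap {x : ℝ} (hx : x ∈ Set.Icc (1 : ℝ) ((2 * k + 2 : ℕ) : ℝ))
    (hne : ∀ s : ℕ, x ≠ s) (hne' : ∀ s : ℕ, cycleMap k π x ≠ s) :
    Covers k π ⌊x⌋₊ ⌊cycleMap k π x⌋₊ := by
  have hmem := linearInterp_mem_uIcc (fun t => (addFixedPoint k π t : ℝ))
    (floor_lt_of_ne hx hne) (Nat.floor_le (by linarith [hx.1])) (Nat.lt_floor_add_one x).le
  change cycleMap k π x ∈ _ at hmem
  have hfloor : ∀ a b : ℕ, (a : ℝ) ≤ cycleMap k π x → cycleMap k π x ≤ b →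
      a ≤ ⌊cycleMap k π x⌋₊ ∧ ⌊cycleMap k π x⌋₊ < b := fun a b ha hb =>
    ⟨Nat.le_floor ha, (Nat.floor_lt (a.cast_nonneg.trans ha)).mpr (lt_of_le_of_ne hb (hne' b))⟩
  rcases Set.mem_uIcc.mp hmem with ⟨h1, h2⟩ | ⟨h1, h2⟩
  · exact .inl (hfloor _ _ h1 h2)
  · exact .inr (hfloor _ _ h1 h2)

/-- A level function on the unit intervals `[s, s + 1]` for which every covering relation raises
the level by at most one, and every parity-preserving one lowers it by at least `2k - 2`. -/
def IsLevel (k : ℕ) (π : ℕ → ℕ) (h : ℕ → ℤ) : Prop :=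
  ∀ s u, s ∈ Set.Icc 1 (2 * k + 1) → u ∈ Set.Icc 1 (2 * k + 1) → Covers k π s u →
    h u ≤ h s + 1 ∧ ((h u - h s) % 2 = 1 ∨ h u + (2 * k - 1) ≤ h s + 1)

theorem le_minimalPeriod_of_odd {h : ℕ → ℤ} (hc : IsCycleLabel (2 * k + 1) π ℓ)
    (hl : IsLevel k π h) {y : ℝ} (hy : y ∈ Set.Icc (1 : ℝ) ((2 * k + 2 : ℕ) : ℝ))
    (hne : y ≠ ((k + 2 : ℕ) : ℝ)) (hodd : Odd (minimalPeriod (cycleMap k π) y)) :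
    2 * k - 1 ≤ minimalPeriod (cycleMap k π) y := by
  set f := cycleMap k π with hf
  have hper : y ∈ periodicPts f := minimalPeriod_pos_iff_mem_periodicPts.mp hodd.pos
  have horb : ∀ n, f^[n] y ∈ Set.Icc (1 : ℝ) ((2 * k + 2 : ℕ) : ℝ) := fun n =>
    (mapsTo_cycleMap hc.mapsTo).iterate n hy
  by_cases hnode : ∀ n (s : ℕ), f^[n] y ≠ s
  · have hclosed : f^[minimalPeriod f y] y = y := iterate_minimalPeriod
    have hfl : ∀ n, ⌊f^[n] y⌋₊ ∈ Set.Icc 1 (2 * k + 1) := fun n =>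
      ⟨(floor_mem (horb n)).1, Nat.lt_succ_iff.mp (floor_lt_of_ne (horb n) (hnode n))⟩
    have := le_of_odd_closed_walk (H := fun n => h ⌊f^[n] y⌋₊) (M := 2 * k - 1)
      (q := minimalPeriod f y) (fun n => ?_) (by simp only [hclosed, iterate_zero_apply]) hodd
    · omega
    · refine hl _ _ (hfl n) (hfl (n + 1)) ?_
      have hne' := hnode (n + 1)
      rw [iterate_succ_apply'] at hne' ⊢
      exact covers_floor_cycleMap (horb n) (hnode n) hne'
  · push Not at hnode
    obtain ⟨n, s, hs⟩ := hnode
    have hmp : minimalPeriod f (s : ℝ) = minimalPeriod f y := by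
      rw [← hs, minimalPeriod_apply_iterate hper]
    have hmem := horb n
    rw [hs] at hmem
    have hs' : s ∈ Set.Icc 1 (2 * k + 2) :=
      ⟨by exact_mod_cast hmem.1, by exact_mod_cast hmem.2⟩
    rcases eq_center_or_exists_skipCenter hs' with rfl | ⟨t, ht, rfl⟩
    · rw [minimalPeriod_eq_one_iff_isFixedPt.mpr (isFixedPt_center k π)] at hmp
      have hfix : IsFixedPt f y := minimalPeriod_eq_one_iff_isFixedPt.mp hmp.symm
      rw [hfix.iterate n] at hs
      exact absurd hs hne
    · have := minimalPeriod_skipCenter hc ht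
      rw [← hf] at this
      omega

/-- If `π` is a cycle with a level function, and `π²` maps `a > s` to `s` and `b ≤ s` to `s + 1`
for some `s ≠ k + 1`, then `π` is realized by a second minimal orbit. -/
theorem realizedSM_of_isLevel {h : ℕ → ℤ} (hk : 2 ≤ k) (hc : IsCycleLabel (2 * k + 1) π ℓ)
    (hl : IsLevel k π h) {s a b : ℕ} (hs : 1 ≤ s) (hs' : s ≠ k + 1) (ha : s < a)
    (ha' : a ≤ 2 * k + 1) (hb : 1 ≤ b) (hb' : b ≤ s) (hπa : π (π a) = s)
    (hπb : π (π b) = s + 1) : RealizedSM k π := by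
  set f := cycleMap k π with hf
  have hcont : Continuous f := continuous_linearInterp _ _
  have hmono : StrictMono fun t => (skipCenter k t : ℝ) :=
    Nat.strictMono_cast.comp (skipCenter_strictMono k)
  have hfirst : (skipCenter k 1 : ℝ) = 1 := by simp [skipCenter]
  have hlast : skipCenter k (2 * k + 1) = 2 * k + 2 := by
    rw [skipCenter, if_neg (by omega)]
  refine ⟨f, fun t => skipCenter k t, hcont, ⟨hmono.strictMonoOn _, fun t ht => ?_,
    hc.bijOn, fun t ht => cycleMap_skipCenter ht⟩, ?_, ?_⟩
  · exact (periodicPtOfPeriod_iff (by omega)).mpr (minimalPeriod_skipCenter hc ht)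
  · have hiter : ∀ {a t : ℕ}, a ∈ Set.Icc 1 (2 * k + 1) → π (π a) = t →
        t ∈ Set.Icc 1 (2 * k + 1) ∧ f^[2 * k - 1] (skipCenter k t) = skipCenter k a := by
      rintro a _ ha rfl
      refine ⟨hc.mapsTo (hc.mapsTo ha), ?_⟩
      have := (hc.iterate_eq_self_iff ha (2 * k + 1)).mpr dvd_rfl
      rw [show 2 * k + 1 = 2 * k - 1 + 1 + 1 by omega, iterate_succ_apply,
        iterate_succ_apply] at this
      rw [hf, iterate_cycleMap_skipCenter hc.mapsTo (hc.mapsTo (hc.mapsTo ha)), this]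
    obtain ⟨hsmem, hfs⟩ := hiter ⟨by omega, ha'⟩ hπa
    obtain ⟨hsmem', hfs'⟩ := hiter ⟨hb, by omega⟩ hπb
    have hlt : (skipCenter k s : ℝ) < skipCenter k (s + 1) := hmono s.lt_succ_self
    obtain ⟨y, hy, hy0⟩ := intermediate_value_Ioo' hlt.le
      (f := fun x => f^[2 * k - 1] x - x) ((hcont.iterate _).sub continuous_id).continuousOn
      (show (0 : ℝ) ∈ _ by
        have h1 : (skipCenter k s : ℝ) < skipCenter k a := hmono ha
        have h2 : (skipCenter k b : ℝ) < skipCenter k (s + 1) := hmono (Nat.lt_succ_of_le hb')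
        rw [Set.mem_Ioo, hfs, hfs']
        constructor <;> linarith)
    have hyper : IsPeriodicPt f (2 * k - 1) y := sub_eq_zero.mp hy0
    have hdvd := hyper.minimalPeriod_dvd
    have hyhull : y ∈ Set.Icc (1 : ℝ) ((2 * k + 2 : ℕ) : ℝ) := by
      have h1 : (1 : ℝ) ≤ skipCenter k s := by exact_mod_cast (skipCenter_mem hsmem).1
      have h2 : (skipCenter k (s + 1) : ℝ) ≤ ((2 * k + 2 : ℕ) : ℝ) := by
        exact_mod_cast (skipCenter_mem hsmem').2
      exact ⟨by linarith [hy.1], by linarith [hy.2]⟩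
    have hyne : y ≠ ((k + 2 : ℕ) : ℝ) := by
      rintro rfl
      have h1 : skipCenter k s < k + 2 := by exact_mod_cast hy.1
      have h2 : k + 2 < skipCenter k (s + 1) := by exact_mod_cast hy.2
      simp only [skipCenter] at h1 h2
      split_ifs at h1 h2 <;> omega
    have hodd : Odd (minimalPeriod f y) := Odd.of_dvd_nat ⟨k - 1, by omega⟩ hdvd
    refine ⟨y, (periodicPtOfPeriod_iff (by omega)).mpr (le_antisymm
      (Nat.le_of_dvd (by omega) hdvd) (le_minimalPeriod_of_odd hc hl hyhull hyne hodd)),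
      fun j => ?_⟩
    simp only [hfirst, hlast]
    exact (mapsTo_cycleMap hc.mapsTo).iterate j hyhull
  · rintro q hq hq1 hqk ⟨y, hy, horb⟩
    simp only [hfirst, hlast] at horb
    have hmp := (periodicPtOfPeriod_iff (by omega)).mp hy
    have hyne : y ≠ ((k + 2 : ℕ) : ℝ) := by
      rintro rfl
      have := minimalPeriod_eq_one_iff_isFixedPt.mpr (isFixedPt_center k π)
      rw [← hf] at this
      omega
    have := le_minimalPeriod_of_odd hc hl (y := y) (horb 0) hyne (by rwa [← hf, hmp])
    rw [← hf] at this
    omega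

end Realization

/-- The position of `t` in the Stefan cycle starting at `1`. -/
def stefanLabel (k t : ℕ) : ℕ :=
  if t = 1 then 0 else if t ≤ k + 1 then 2 * (k + 1 - t) + 1 else 2 * (t - k - 1)

/-- Levels growing by two with the distance from the center, even on the left and odd on the
right, except that they are repeated once at `A` on the left and at `B` on the right. -/
def centerLevel (k A B s : ℕ) : ℤ :=
  if s ≤ k + 1 then (if s < A then 2 * (k - s) else 2 * (k + 1 - s))
  else (if B < s then 2 * s - 2 * k - 5 else 2 * s - 2 * k - 3)

/-- The permutation exchanging `A` and `A + 1`. -/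
def adjSwap (A t : ℕ) : ℕ := if t = A then A + 1 else if t = A + 1 then A else t

/-- The conjugate of the Stefan permutation by the exchange of `i - 1` and `i`
is realized by a second minimal orbit. -/
theorem realizedSM_stefan_conj_left {k i : ℕ} (hi1 : 2 < i) (hi2 : i < k) {π : ℕ → ℕ}
    (hπ : ∀ t, π t = if t = i-1 then (2*k-i)+3 else if t = i then (2*k-i)+4
      else if t = (2*k-i)+2 then i-1 else if t = (2*k-i)+3 then i
      else stefanPerm k t) :
    RealizedSM k π := by
  refine realizedSM_of_isLevel (ℓ := fun t => stefanLabel k (adjSwap (i - 1) t))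
    (h := centerLevel k i (2 * k + 3 - i)) (s := i - 1) (a := i + 1) (b := i - 1)
    (by omega) ⟨fun t ht => ?_, fun t ht => ?_, fun t ht u hu => ?_, fun t ht => ?_⟩
    (fun s u hs hu hcov => ?_) (by omega) (by omega) (by omega) (by omega) (by omega)
    (by omega) ?_ ?_
  · simp only [Set.mem_Icc, hπ, stefanPerm] at *
    grind (splits := 30)
  · simp only [Set.mem_Icc, stefanLabel, adjSwap] at *
    grind (splits := 30)
  · simp only [Set.mem_Icc, stefanLabel, adjSwap] at *
    grind (splits := 30)
  · have h := hπ t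
    clear hπ
    generalize π t = v at h ⊢
    simp only [Set.mem_Icc, stefanPerm, stefanLabel, adjSwap] at *
    grind (splits := 30)
  · simp only [Covers, addFixedPoint, skipCenter, Set.mem_Icc, hπ, stefanPerm,
      centerLevel] at *
    grind (splits := 40)
  · simp only [hπ, stefanPerm]
    grind (splits := 30)
  · simp only [hπ, stefanPerm]
    grind (splits := 30)

/-- The conjugate of the Stefan permutation by the exchange of `2k + 2 - i` and `2k + 3 - i`
is realized by a second minimal orbit. -/
theorem realizedSM_stefan_conj_right {k i : ℕ} (hi1 : 2 < i) (hi2 : i < k) {π : ℕ → ℕ}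
    (hπ : ∀ t, π t = if t = i then (2*k-i)+2 else if t = i+1 then (2*k-i)+3
      else if t = (2*k-i)+2 then i-1 else if t = (2*k-i)+3 then i
      else stefanPerm k t) :
    RealizedSM k π := by
  refine realizedSM_of_isLevel (ℓ := fun t => stefanLabel k (adjSwap (2 * k + 2 - i) t))
    (h := centerLevel k i (2 * k + 2 - i)) (s := 2 * k - i + 2) (a := 2 * k - i + 3)
    (b := 2 * k - i + 1)
    (by omega) ⟨fun t ht => ?_, fun t ht => ?_, fun t ht u hu => ?_, fun t ht => ?_⟩
    (fun s u hs hu hcov => ?_) (by omega) (by omega) (by omega) (by omega) (by omega)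
    (by omega) ?_ ?_
  · simp only [Set.mem_Icc, hπ, stefanPerm] at *
    grind (splits := 30)
  · simp only [Set.mem_Icc, stefanLabel, adjSwap] at *
    grind (splits := 30)
  · simp only [Set.mem_Icc, stefanLabel, adjSwap] at *
    grind (splits := 30)
  · have h := hπ t
    clear hπ
    generalize π t = v at h ⊢
    simp only [Set.mem_Icc, stefanPerm, stefanLabel, adjSwap] at *
    grind (splits := 30)
  · simp only [Covers, addFixedPoint, skipCenter, Set.mem_Icc, hπ, stefanPerm,
      centerLevel] at *
    grind (splits := 40)
  · simp only [hπ, stefanPerm]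
    grind (splits := 30)
  · simp only [hπ, stefanPerm]
    grind (splits := 30)

/-- The conjugate of the Stefan permutation by the exchange of `i`, `i + 1` and of `2k + 2 - i`,
`2k + 3 - i` is realized by a second minimal orbit. -/
theorem realizedSM_stefan_conj_left_right {k i : ℕ} (hi1 : 2 < i) (hi2 : i < k) {π : ℕ → ℕ}
    (hπ : ∀ t, π t = if t = (2*k-i)+1 then i else if t = (2*k-i)+2 then i-1
      else if t = (2*k-i)+3 then i+1 else stefanPerm k t) :
    RealizedSM k π := by
  refine realizedSM_of_isLevel
    (ℓ := fun t => stefanLabel k (adjSwap i (adjSwap (2 * k + 2 - i) t)))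
    (h := centerLevel k (i + 1) (2 * k + 2 - i)) (s := i) (a := i + 2) (b := i)
    (by omega) ⟨fun t ht => ?_, fun t ht => ?_, fun t ht u hu => ?_, fun t ht => ?_⟩
    (fun s u hs hu hcov => ?_) (by omega) (by omega) (by omega) (by omega) (by omega)
    (by omega) ?_ ?_
  · simp only [Set.mem_Icc, hπ, stefanPerm] at *
    grind (splits := 30)
  · simp only [Set.mem_Icc, stefanLabel, adjSwap] at *
    grind (splits := 30)
  · simp only [Set.mem_Icc, stefanLabel, adjSwap] at *
    grind (splits := 30)
  · have h := hπ t
    clear hπ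
    generalize π t = v at h ⊢
    simp only [Set.mem_Icc, stefanPerm, stefanLabel, adjSwap] at *
    grind (splits := 30)
  · simp only [Covers, addFixedPoint, skipCenter, Set.mem_Icc, hπ, stefanPerm,
      centerLevel] at *
    grind (splits := 40)
  · simp only [hπ, stefanPerm]
    grind (splits := 30)
  · simp only [hπ, stefanPerm]
    grind (splits := 30)

/-- The conjugate of the Stefan permutation by the exchange of `i - 1`, `i` and of `2k + 3 - i`,
`2k + 4 - i` is realized by a second minimal orbit. -/
theorem realizedSM_stefan_conj_left_right' {k i : ℕ} (hi1 : 2 < i) (hi2 : i < k) {π : ℕ → ℕ}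
    (hπ : ∀ t, π t = if t = (2*k-i)+2 then i-1 else if t = (2*k-i)+3 then i-2
      else if t = (2*k-i)+4 then i else stefanPerm k t) :
    RealizedSM k π := by
  refine realizedSM_of_isLevel
    (ℓ := fun t => stefanLabel k (adjSwap (i - 1) (adjSwap (2 * k + 3 - i) t)))
    (h := centerLevel k i (2 * k + 3 - i)) (s := i - 1) (a := i + 1) (b := i - 1)
    (by omega) ⟨fun t ht => ?_, fun t ht => ?_, fun t ht u hu => ?_, fun t ht => ?_⟩
    (fun s u hs hu hcov => ?_) (by omega) (by omega) (by omega) (by omega) (by omega)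
    (by omega) ?_ ?_
  · simp only [Set.mem_Icc, hπ, stefanPerm] at *
    grind (splits := 30)
  · simp only [Set.mem_Icc, stefanLabel, adjSwap] at *
    grind (splits := 30)
  · simp only [Set.mem_Icc, stefanLabel, adjSwap] at *
    grind (splits := 30)
  · have h := hπ t
    clear hπ
    generalize π t = v at h ⊢
    simp only [Set.mem_Icc, stefanPerm, stefanLabel, adjSwap] at *
    grind (splits := 30)
  · simp only [Covers, addFixedPoint, skipCenter, Set.mem_Icc, hπ, stefanPerm,
      centerLevel] at *
    grind (splits := 40)
  · simp only [hπ, stefanPerm]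
    grind (splits := 30)
  · simp only [hπ, stefanPerm]
    grind (splits := 30)

/-- The four second minimal permutations arising from setting `(i, 2k−i+1)`,
`2 < i < k`, with `j = 2k − i`. -/
theorem realized_setting_i_jp1 (k i : ℕ) (hk : 4 ≤ k) (hi1 : 2 < i)
    (hi2 : i < k) :
    RealizedSM k (fun t =>
      if t = i-1 then (2*k-i)+3 else if t = i then (2*k-i)+4
      else if t = (2*k-i)+2 then i-1 else if t = (2*k-i)+3 then i
      else stefanPerm k t) ∧
    RealizedSM k (fun t =>
      if t = i then (2*k-i)+2 else if t = i+1 then (2*k-i)+3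
      else if t = (2*k-i)+2 then i-1 else if t = (2*k-i)+3 then i
      else stefanPerm k t) ∧
    RealizedSM k (fun t =>
      if t = (2*k-i)+1 then i else if t = (2*k-i)+2 then i-1
      else if t = (2*k-i)+3 then i+1 else stefanPerm k t) ∧
    RealizedSM k (fun t =>
      if t = (2*k-i)+2 then i-1 else if t = (2*k-i)+3 then i-2
      else if t = (2*k-i)+4 then i else stefanPerm k t) := by
  exact ⟨realizedSM_stefan_conj_left hi1 hi2 fun _ => rfl,
    realizedSM_stefan_conj_right hi1 hi2 fun _ => rfl,
    realizedSM_stefan_conj_left_right hi1 hi2 fun _ => rfl,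
    realizedSM_stefan_conj_left_right' hi1 hi2 fun _ => rfl⟩
end

section
/- Let k ≥ 4. Each of the following four permutations π of {1,…,2k+1} is realized by a second minimal (2k+1)-orbit of some continuous map f : ℝ → ℝ: (a) π agrees with the Stefan permutation π_S except π(k) = k+2, π(k+1) = k+3, π(k+2) = k−1, π(k+3) = k; (b) π agrees with π_S except π(k+2) = k−1, π(k+3) = k−2, π(k+4) = k; (c) π agrees with π_S except π(1) = k, π(k+2) = k−1, π(k+3) = k+1; (d) π agrees with π_S except π(k−1) = k+3, π(k) = k+4, π(k+2) = k−1, π(k+3) = k. -/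
/-- A continuous function interpolating `F` linearly between consecutive integers in `[0, N]`. -/
theorem exists_continuous_linear_interpolation (F : ℕ → ℝ) (N : ℕ) :
    ∃ f : ℝ → ℝ, Continuous f ∧ (∀ x : ℝ, N ≤ x → f x = F N) ∧
      ∀ i < N, ∀ x : ℝ, i ≤ x → x ≤ i + 1 → f x = F i + (x - i) * (F (i + 1) - F i) := by
  induction N with
  | zero => exact ⟨fun _ => F 0, continuous_const, fun _ _ => rfl, fun i hi => absurd hi (by omega)⟩
  | succ N ih =>
    obtain ⟨f, hf, hN, hi⟩ := ih
    refine ⟨fun x => f x + max 0 (min 1 (x - N)) * (F (N + 1) - F N), by fun_prop, ?_, ?_⟩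
    · intro x hx
      push_cast at hx
      have h1 : max 0 (min 1 (x - N)) = 1 := by
        rw [min_eq_left (by linarith)]; norm_num
      simp only [h1, hN x (by linarith)]
      ring
    · intro i hiN x hx hx'
      rcases Nat.lt_succ_iff_lt_or_eq.mp hiN with h | rfl
      · have h2 : (i : ℝ) + 1 ≤ N := by exact_mod_cast h
        have h1 : max 0 (min 1 (x - N)) = 0 :=
          max_eq_left ((min_le_right _ _).trans (by linarith))
        simp only [h1, hi i h x hx hx']
        ring
      · have h1 : max 0 (min 1 (x - i)) = x - i := by
          rw [min_eq_right (by linarith), max_eq_right (by linarith)]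
        simp only [h1, hN x hx]

theorem PeriodicPtOfPeriod.apply {f : ℝ → ℝ} {n : ℕ} {x : ℝ} (hn : 1 ≤ n)
    (h : PeriodicPtOfPeriod f n x) : PeriodicPtOfPeriod f n (f x) := by
  refine ⟨by rw [← Function.iterate_succ_apply, Function.iterate_succ_apply', h.1], ?_⟩
  intro j hj hjn hfix
  refine h.2 j hj hjn ?_
  have h1 : f^[n - 1] (f x) = x := by
    rw [← Function.iterate_succ_apply, Nat.succ_eq_add_one, Nat.sub_add_cancel hn, h.1]
  calc f^[j] x = f^[j] (f^[n - 1] (f x)) := by rw [h1]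
    _ = f^[n - 1] (f^[j] (f x)) := by
      rw [← Function.iterate_add_apply, ← Function.iterate_add_apply, add_comm]
    _ = x := by rw [hfix, h1]

theorem PeriodicPtOfPeriod.iterate {f : ℝ → ℝ} {n : ℕ} {x : ℝ} (hn : 1 ≤ n)
    (h : PeriodicPtOfPeriod f n x) (m : ℕ) : PeriodicPtOfPeriod f n (f^[m] x) := by
  induction m with
  | zero => exact h
  | succ m ih => rw [Function.iterate_succ_apply']; exact ih.apply hn

/-- If each step of an orbit either changes sides and raises `H` by at most one, or keeps the side
and lowers `H` by at least `M`, then an odd period exceeds `M`. -/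
theorem lt_of_odd_period_of_potential {f : ℝ → ℝ} {y : ℝ} {q : ℕ} (hq : Odd q) (hy : f^[q] y = y)
    (H : ℝ → ℤ) (S : ℝ → Prop) (M : ℕ)
    (hstep : ∀ n, ((S (f (f^[n] y)) ↔ ¬ S (f^[n] y)) ∧ H (f (f^[n] y)) ≤ H (f^[n] y) + 1) ∨
      ((S (f (f^[n] y)) ↔ S (f^[n] y)) ∧ H (f (f^[n] y)) + M ≤ H (f^[n] y))) :
    M < q := by
  have key : ∀ n : ℕ, ∃ m : ℕ, H (f^[n] y) + m * (M + 1) ≤ H y + n ∧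
      ((S (f^[n] y) ↔ S y) ↔ Even (n + m)) := by
    intro n
    induction n with
    | zero => exact ⟨0, by simp, by simp⟩
    | succ n ih =>
      obtain ⟨m, h1, h2⟩ := ih
      rw [Function.iterate_succ_apply']
      rcases hstep n with ⟨hs, hH⟩ | ⟨hs, hH⟩
      · refine ⟨m, by push_cast; linarith, ?_⟩
        rw [show n + 1 + m = n + m + 1 by ring, Nat.even_add_one, ← h2]
        tauto
      · refine ⟨m + 1, by push_cast; linarith, ?_⟩
        rw [show n + 1 + (m + 1) = n + m + 1 + 1 by ring, Nat.even_add_one, Nat.even_add_one,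
          ← h2]
        tauto
  obtain ⟨m, h1, h2⟩ := key q
  rw [hy] at h1 h2
  have hm : Even (q + m) := h2.mp Iff.rfl
  have hm1 : 1 ≤ m := by
    rcases Nat.eq_zero_or_pos m with rfl | h
    · rw [add_zero] at hm
      exact absurd hm (Nat.not_even_iff_odd.mpr hq)
    · exact h
  have h3 : m * (M + 1) ≤ q := by
    have : (m : ℤ) * (M + 1) ≤ q := by linarith
    exact_mod_cast this
  nlinarith

/-- `τ` counts the steps that `F` takes to reach `1`, and `F` permutes `{1,…,2k+2} ∖ {k+2}`
cyclically. -/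
structure IsCountdown (k : ℕ) (F τ : ℕ → ℕ) : Prop where
  maps : ∀ j, 1 ≤ j → j ≤ 2 * k + 2 → j ≠ k + 2 → 1 ≤ F j ∧ F j ≤ 2 * k + 2 ∧ F j ≠ k + 2
  inj : ∀ i j, 1 ≤ i → i ≤ 2 * k + 2 → i ≠ k + 2 → 1 ≤ j → j ≤ 2 * k + 2 → j ≠ k + 2 →
    τ i = τ j → i = j
  le : ∀ j, 1 ≤ j → j ≤ 2 * k + 2 → j ≠ k + 2 → τ j ≤ 2 * k
  one : τ 1 = 0
  map_one : τ (F 1) = 2 * k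
  step : ∀ j, 2 ≤ j → j ≤ 2 * k + 2 → j ≠ k + 2 → τ (F j) + 1 = τ j

namespace IsCountdown

variable {k : ℕ} {F τ : ℕ → ℕ}

theorem iterate_mem (h : IsCountdown k F τ) {j : ℕ} (h1 : 1 ≤ j) (h2 : j ≤ 2 * k + 2)
    (h3 : j ≠ k + 2) (n : ℕ) :
    1 ≤ F^[n] j ∧ F^[n] j ≤ 2 * k + 2 ∧ F^[n] j ≠ k + 2 := by
  induction n with
  | zero => exact ⟨h1, h2, h3⟩
  | succ n ih =>
    rw [Function.iterate_succ_apply']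
    exact h.maps _ ih.1 ih.2.1 ih.2.2

theorem iterate_modEq (h : IsCountdown k F τ) {j : ℕ} (h1 : 1 ≤ j) (h2 : j ≤ 2 * k + 2)
    (h3 : j ≠ k + 2) (n : ℕ) : τ (F^[n] j) + n ≡ τ j [MOD 2 * k + 1] := by
  induction n with
  | zero => rfl
  | succ n ih =>
    obtain ⟨i1, i2, i3⟩ := h.iterate_mem h1 h2 h3 n
    rw [Function.iterate_succ_apply']
    refine Nat.ModEq.trans ?_ ih
    by_cases hi : F^[n] j = 1
    · rw [hi, h.map_one, h.one]
      have : 2 * k + (n + 1) = 0 + n + (2 * k + 1) := by ring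
      rw [this]
      exact Nat.add_modEq_right
    · have := h.step (F^[n] j) (by omega) i2 i3
      rw [show τ (F (F^[n] j)) + (n + 1) = τ (F^[n] j) + n by omega]

theorem iterate_eq_self_iff (h : IsCountdown k F τ) {j : ℕ} (h1 : 1 ≤ j) (h2 : j ≤ 2 * k + 2)
    (h3 : j ≠ k + 2) (n : ℕ) : F^[n] j = j ↔ 2 * k + 1 ∣ n := by
  have hmod := h.iterate_modEq h1 h2 h3 n
  obtain ⟨i1, i2, i3⟩ := h.iterate_mem h1 h2 h3 n
  constructor
  · intro he
    rw [he] at hmod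
    exact Nat.modEq_zero_iff_dvd.mp (Nat.ModEq.add_left_cancel' (τ j) (by simpa using hmod))
  · intro hd
    refine h.inj _ _ i1 i2 i3 h1 h2 h3 ?_
    have h0 : τ (F^[n] j) + n ≡ τ j + n [MOD 2 * k + 1] := by
      refine hmod.trans ?_
      simpa using (Nat.ModEq.add_left (τ j) (Nat.modEq_zero_iff_dvd.mpr hd)).symm
    refine Nat.ModEq.eq_of_lt_of_lt (Nat.ModEq.add_right_cancel' n h0) ?_ ?_
    · have := h.le _ i1 i2 i3; omega
    · have := h.le _ h1 h2 h3; omega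

theorem iterate_eq_one (h : IsCountdown k F τ) {j : ℕ} (h1 : 1 ≤ j) (h2 : j ≤ 2 * k + 2)
    (h3 : j ≠ k + 2) : F^[τ j] j = 1 := by
  have hmod := h.iterate_modEq h1 h2 h3 (τ j)
  obtain ⟨i1, i2, i3⟩ := h.iterate_mem h1 h2 h3 (τ j)
  have h0 : τ (F^[τ j] j) ≡ 0 [MOD 2 * k + 1] :=
    Nat.ModEq.add_right_cancel' (τ j) (by simpa using hmod)
  have hle := h.le _ i1 i2 i3
  have hz := Nat.ModEq.eq_of_lt_of_lt h0 (by omega) (by omega)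
  by_contra hne
  have := h.step _ (by omega) i2 i3
  omega

end IsCountdown

/-- Position of the `t`-th orbit point when the integer `k + 2` is reserved for a fixed point. -/
def orbitPos (k t : ℕ) : ℕ := if t ≤ k + 1 then t else t + 1

theorem orbitPos_mem {k t : ℕ} (h1 : 1 ≤ t) (h2 : t ≤ 2 * k + 1) :
    1 ≤ orbitPos k t ∧ orbitPos k t ≤ 2 * k + 2 ∧ orbitPos k t ≠ k + 2 := by
  unfold orbitPos; split_ifs <;> omega

theorem orbitPos_strictMono (k : ℕ) : StrictMono (orbitPos k) := by
  intro s t hst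
  unfold orbitPos; split_ifs <;> omega

/-- A cyclic permutation whose Markov graph, with the fixed point `k + 2` inserted, admits a
potential `h` is realized by a second minimal orbit of its piecewise linear extension. -/
theorem realizedSM_of_potential {k : ℕ} (hk : 4 ≤ k) {π F τ : ℕ → ℕ} {h : ℕ → ℤ} {v : ℕ}
    (hτ : IsCountdown k F τ)
    (hπ : ∀ t, 1 ≤ t → t ≤ 2 * k + 1 → 1 ≤ π t ∧ π t ≤ 2 * k + 1)
    (hFπ : ∀ t, 1 ≤ t → t ≤ 2 * k + 1 → F (orbitPos k t) = orbitPos k (π t))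
    (hF1' : 3 ≤ F 1) (hF1 : F 1 ≤ k + 1) (hF2 : k + 2 ≤ F 2) (hFk1 : k + 3 ≤ F (k + 1))
    (hFk2 : F (k + 2) = k + 2) (hFk3 : F (k + 3) = k - 1)
    (hv : k - 1 ≤ v) (hv' : v ≤ k) (hτv : τ v = 2 * k - 4)
    (hedge : ∀ i j, 1 ≤ i → i ≤ 2 * k + 1 → 1 ≤ j → j ≤ 2 * k + 1 →
      (F i ≤ j ∧ j + 1 ≤ F (i + 1) ∨ F (i + 1) ≤ j ∧ j + 1 ≤ F i) →
      ((j ≤ k + 1 ↔ ¬ i ≤ k + 1) ∧ h j ≤ h i + 1) ∨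
      ((j ≤ k + 1 ↔ i ≤ k + 1) ∧ h j + (2 * k - 2) ≤ h i)) :
    RealizedSM k π := by
  obtain ⟨f, hf, hfN, hflin⟩ :=
    exists_continuous_linear_interpolation (fun n => (F n : ℝ)) (2 * k + 2)
  have hmapsF : ∀ j, 1 ≤ j → j ≤ 2 * k + 2 → 1 ≤ F j ∧ F j ≤ 2 * k + 2 := by
    intro j h1 h2
    by_cases hj : j = k + 2
    · subst hj; omega
    · exact ⟨(hτ.maps j h1 h2 hj).1, (hτ.maps j h1 h2 hj).2.1⟩
  have hfF : ∀ j : ℕ, j ≤ 2 * k + 2 → f j = F j := by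
    intro j hj
    rcases hj.eq_or_lt with rfl | hj
    · exact hfN _ le_rfl
    · rw [hflin j hj j le_rfl (by linarith)]; ring
  have hiter : ∀ (n j : ℕ), 1 ≤ j → j ≤ 2 * k + 2 → f^[n] (j : ℝ) = (F^[n] j : ℕ) := by
    intro n
    induction n with
    | zero => intro j _ _; rfl
    | succ n ih =>
      intro j h1 h2
      rw [Function.iterate_succ_apply, Function.iterate_succ_apply, hfF j h2]
      exact ih _ (hmapsF j h1 h2).1 (hmapsF j h1 h2).2
  have hper : ∀ j, 1 ≤ j → j ≤ 2 * k + 2 → j ≠ k + 2 →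
      PeriodicPtOfPeriod f (2 * k + 1) (j : ℝ) := by
    intro j h1 h2 h3
    refine ⟨?_, fun n hn hn' => ?_⟩
    · rw [hiter _ _ h1 h2, (hτ.iterate_eq_self_iff h1 h2 h3 _).mpr dvd_rfl]
    · rw [hiter _ _ h1 h2, Ne, Nat.cast_inj, hτ.iterate_eq_self_iff h1 h2 h3]
      exact fun hd => absurd (Nat.le_of_dvd hn hd) (by omega)
  have hfloor : ∀ x : ℝ, 1 ≤ x → x ≤ 2 * k + 2 → (∀ n : ℕ, x ≠ n) →
      1 ≤ ⌊x⌋₊ ∧ ⌊x⌋₊ ≤ 2 * k + 1 ∧ (⌊x⌋₊ : ℝ) < x ∧ x < ⌊x⌋₊ + 1 := by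
    intro x h1 h2 hne
    have hlt : (⌊x⌋₊ : ℝ) < x :=
      lt_of_le_of_ne (Nat.floor_le (by linarith)) (fun e => hne _ e.symm)
    refine ⟨Nat.le_floor (by exact_mod_cast h1), ?_, hlt, Nat.lt_floor_add_one x⟩
    have : ((⌊x⌋₊ : ℕ) : ℝ) < ((2 * k + 2 : ℕ) : ℝ) := by push_cast; linarith
    have := Nat.cast_lt.mp this
    omega
  have hmaps : ∀ x : ℝ, 1 ≤ x → x ≤ 2 * k + 2 → 1 ≤ f x ∧ f x ≤ 2 * k + 2 := by
    intro x h1 h2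
    by_cases hx : ∃ n : ℕ, x = n
    · obtain ⟨n, rfl⟩ := hx
      have h1' : 1 ≤ n := by exact_mod_cast h1
      have h2' : n ≤ 2 * k + 2 := by exact_mod_cast h2
      rw [hfF n h2']
      exact ⟨by exact_mod_cast (hmapsF n h1' h2').1, by exact_mod_cast (hmapsF n h1' h2').2⟩
    · push Not at hx
      obtain ⟨i1, i2, i3, i4⟩ := hfloor x h1 h2 hx
      have a := hmapsF _ i1 (by omega)
      have b := hmapsF (⌊x⌋₊ + 1) (by omega) (by omega)
      have a1 : (1 : ℝ) ≤ F ⌊x⌋₊ := by exact_mod_cast a.1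
      have a2 : (F ⌊x⌋₊ : ℝ) ≤ 2 * k + 2 := by exact_mod_cast a.2
      have b1 : (1 : ℝ) ≤ F (⌊x⌋₊ + 1) := by exact_mod_cast b.1
      have b2 : (F (⌊x⌋₊ + 1) : ℝ) ≤ 2 * k + 2 := by exact_mod_cast b.2
      rw [hflin _ (by omega) x i3.le i4.le]
      constructor <;> nlinarith
  have hmapsIter : ∀ x : ℝ, 1 ≤ x → x ≤ 2 * k + 2 → ∀ n, 1 ≤ f^[n] x ∧ f^[n] x ≤ 2 * k + 2 := by
    intro x h1 h2 n
    induction n with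
    | zero => exact ⟨h1, h2⟩
    | succ n ih => rw [Function.iterate_succ_apply']; exact hmaps _ ih.1 ih.2
  have hno : ∀ q, Odd q → 1 < q → q < 2 * k - 1 → ∀ y, PeriodicPtOfPeriod f q y →
      ¬ ∀ j : ℕ, 1 ≤ f^[j] y ∧ f^[j] y ≤ 2 * k + 2 := by
    intro q hq hq1 hq2 y hy horb
    have hne : ∀ n m : ℕ, f^[n] y ≠ m := by
      intro n m hnm
      have hp := hy.iterate hq1.le n
      have hI := horb n
      rw [hnm] at hp hI
      have h1 : 1 ≤ m := by exact_mod_cast hI.1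
      have h2 : m ≤ 2 * k + 2 := by exact_mod_cast hI.2
      by_cases h3 : m = k + 2
      · refine hp.2 1 le_rfl hq1 ?_
        rw [Function.iterate_one, hfF m h2, h3, hFk2]
      · exact (hper m h1 h2 h3).2 q hq1.le (by omega) hp.1
    have := lt_of_odd_period_of_potential hq hy.1 (fun x => h ⌊x⌋₊) (fun x => ⌊x⌋₊ ≤ k + 1)
      (2 * k - 2) ?_
    · omega
    intro n
    have hne' := hne (n + 1)
    have hI' := horb (n + 1)
    rw [Function.iterate_succ_apply'] at hne' hI'
    obtain ⟨i1, i2, i3, i4⟩ := hfloor _ (horb n).1 (horb n).2 (hne n)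
    obtain ⟨j1, j2, j3, j4⟩ := hfloor _ hI'.1 hI'.2 hne'
    have hlin := hflin _ (by omega) _ i3.le i4.le
    generalize f^[n] y = x at *
    generalize f x = z at *
    have hcast : ((2 * k - 2 : ℕ) : ℤ) = 2 * k - 2 := by omega
    rw [hcast]
    refine hedge _ _ i1 i2 j1 j2 ?_
    have hbetween : ∀ a b : ℕ, (a : ℝ) < z → z < b → a ≤ ⌊z⌋₊ ∧ ⌊z⌋₊ + 1 ≤ b := by
      intro a b ha hb
      exact ⟨Nat.le_floor ha.le, (Nat.floor_lt (by linarith)).mpr hb⟩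
    rcases lt_trichotomy (F ⌊x⌋₊) (F (⌊x⌋₊ + 1)) with hlt | heq | hgt
    · have : (F ⌊x⌋₊ : ℝ) < F (⌊x⌋₊ + 1) := by exact_mod_cast hlt
      exact Or.inl (hbetween _ _ (by nlinarith) (by nlinarith))
    · refine absurd ?_ (hne' (F ⌊x⌋₊))
      rw [hlin, heq]; ring
    · have : (F (⌊x⌋₊ + 1) : ℝ) < F ⌊x⌋₊ := by exact_mod_cast hgt
      exact Or.inr (hbetween _ _ (by nlinarith) (by nlinarith))
  have hk4 : (4 : ℝ) ≤ k := by exact_mod_cast hk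
  have hf1 : f 1 ≤ k + 1 := by
    have := hfF 1 (by omega)
    rw [Nat.cast_one] at this
    rw [this]; exact_mod_cast hF1
  have hf2 : (k : ℝ) + 2 ≤ f 2 := by
    have := hfF 2 (by omega)
    rw [Nat.cast_ofNat] at this
    rw [this]; exact_mod_cast hF2
  have hfk1 : (k : ℝ) + 3 ≤ f (k + 1) := by
    have := hfF (k + 1) (by omega)
    push_cast at this
    rw [this]; exact_mod_cast hFk1
  have hfk2 : f (k + 2) = k + 2 := by
    have := hfF (k + 2) (by omega)
    rw [hFk2] at this
    exact_mod_cast this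
  have hfk3 : f (k + 3) = ((k - 1 : ℕ) : ℝ) := by
    have := hfF (k + 3) (by omega)
    rw [hFk3] at this
    exact_mod_cast this
  have hvr : ((k - 1 : ℕ) : ℝ) ≤ v := by exact_mod_cast hv
  have hvr' : (v : ℝ) ≤ k := by exact_mod_cast hv'
  obtain ⟨r, hr, hfr⟩ := intermediate_value_Icc' (show (k : ℝ) + 2 ≤ k + 3 by linarith)
    hf.continuousOn (show (v : ℝ) ∈ Set.Icc (f (k + 3)) (f (k + 2)) from
      ⟨by linarith, by linarith⟩)
  obtain ⟨p, hp, hfp⟩ := intermediate_value_Icc' (show (k : ℝ) + 1 ≤ k + 2 by linarith)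
    hf.continuousOn (show r ∈ Set.Icc (f (k + 2)) (f (k + 1)) from
      ⟨by linarith [hr.1], by linarith [hr.2]⟩)
  obtain ⟨z, hz, hfz⟩ := intermediate_value_Icc (show (1 : ℝ) ≤ 2 by norm_num)
    hf.continuousOn (show p ∈ Set.Icc (f 1) (f 2) from
      ⟨by linarith [hp.1], by linarith [hp.2]⟩)
  have hgz : f^[2 * k - 1] z = 1 := by
    rw [show 2 * k - 1 = (2 * k - 4) + 1 + 1 + 1 by omega, Function.iterate_succ_apply,
      Function.iterate_succ_apply, Function.iterate_succ_apply, hfz, hfp, hfr,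
      hiter _ _ (by omega) (by omega), ← hτv,
      hτ.iterate_eq_one (by omega) (by omega) (by omega), Nat.cast_one]
  have hg1 : 1 ≤ f^[2 * k - 1] 1 := (hmapsIter 1 le_rfl (by linarith) _).1
  obtain ⟨y, hy, hfy⟩ := intermediate_value_Icc' (f := fun x => f^[2 * k - 1] x - x) hz.1
    (((hf.iterate _).sub continuous_id).continuousOn)
    (show (0 : ℝ) ∈ _ from ⟨by linarith [hz.1], by linarith⟩)
  have hy2 : y ≤ 2 := hy.2.trans hz.2
  have hgy : f^[2 * k - 1] y = y := by simpa [sub_eq_zero] using hfy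
  have horby := hmapsIter y hy.1 (by linarith)
  have hIcc : ∀ {x : ℝ}, x ∈ Set.Icc ((orbitPos k 1 : ℕ) : ℝ) (orbitPos k (2 * k + 1) : ℕ) ↔
      1 ≤ x ∧ x ≤ 2 * k + 2 := by
    intro x
    have e1 : orbitPos k 1 = 1 := by simp [orbitPos]
    have e2 : orbitPos k (2 * k + 1) = 2 * k + 2 := by
      unfold orbitPos; split_ifs <;> omega
    rw [e1, e2, Set.mem_Icc]
    push_cast
    rfl
  have hyper : PeriodicPtOfPeriod f (2 * k - 1) y := by
    set d := Function.minimalPeriod f y with hd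
    have hp : Function.IsPeriodicPt f (2 * k - 1) y := hgy
    have hdvd : d ∣ 2 * k - 1 := hp.minimalPeriod_dvd
    have hd0 : 0 < d := hp.minimalPeriod_pos (by omega)
    have hodd : Odd d := Odd.of_dvd_nat ⟨k - 1, by omega⟩ hdvd
    have hmin : ∀ j, 1 ≤ j → j < d → f^[j] y ≠ y := fun j hj hjd hfix =>
      absurd (Function.IsPeriodicPt.minimalPeriod_le hj hfix) (by omega)
    have hfd : f^[d] y = y := Function.iterate_minimalPeriod
    have hd1 : d ≠ 1 := by
      intro h1
      rw [h1, Function.iterate_one] at hfd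
      have hlin := hflin 1 (by omega) y (by exact_mod_cast hy.1) (by push_cast; linarith)
      have a1 : (3 : ℝ) ≤ F 1 := by exact_mod_cast hF1'
      have a2 : (F 1 : ℝ) ≤ F (1 + 1) := by exact_mod_cast (show F 1 ≤ F 2 by omega)
      push_cast at hlin
      nlinarith [hy.1, mul_nonneg (sub_nonneg.mpr hy.1) (sub_nonneg.mpr a2)]
    rcases (Nat.le_of_dvd (by omega) hdvd).lt_or_eq with hlt | heq
    · exact absurd horby (hno d hodd (by omega) hlt y ⟨hfd, hmin⟩)
    · rw [← heq]; exact ⟨hfd, hmin⟩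
  have hFinj : ∀ i j, 1 ≤ i → i ≤ 2 * k + 2 → i ≠ k + 2 → 1 ≤ j → j ≤ 2 * k + 2 → j ≠ k + 2 →
      F i = F j → i = j := by
    intro i j i1 i2 i3 j1 j2 j3 hij
    rw [← (hτ.iterate_eq_self_iff i1 i2 i3 _).mpr dvd_rfl,
      ← (hτ.iterate_eq_self_iff j1 j2 j3 _).mpr dvd_rfl, Function.iterate_succ_apply,
      Function.iterate_succ_apply, hij]
  have hπmaps : Set.MapsTo π (Set.Icc 1 (2 * k + 1)) (Set.Icc 1 (2 * k + 1)) :=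
    fun t ht => hπ t ht.1 ht.2
  have hπinj : Set.InjOn π (Set.Icc 1 (2 * k + 1)) := by
    intro s hs t ht hst
    obtain ⟨s1, s2, s3⟩ := orbitPos_mem hs.1 hs.2
    obtain ⟨t1, t2, t3⟩ := orbitPos_mem ht.1 ht.2
    refine (orbitPos_strictMono k).injective (hFinj _ _ s1 s2 s3 t1 t2 t3 ?_)
    rw [hFπ s hs.1 hs.2, hFπ t ht.1 ht.2, hst]
  refine ⟨f, fun t => (orbitPos k t : ℕ), hf, ⟨?_, ?_,
    ((Set.finite_Icc _ _).injOn_iff_bijOn_of_mapsTo hπmaps).mp hπinj, ?_⟩, ⟨y, hyper, ?_⟩, ?_⟩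
  · exact (Nat.strictMono_cast.comp (orbitPos_strictMono k)).strictMonoOn _
  · intro t ht
    obtain ⟨t1, t2, t3⟩ := orbitPos_mem ht.1 ht.2
    exact hper _ t1 t2 t3
  · intro t ht
    rw [hfF _ (orbitPos_mem ht.1 ht.2).2.1, hFπ t ht.1 ht.2]
  · exact fun j => hIcc.mpr (horby j)
  · rintro q hq hq1 hq2 ⟨x, hx, hxo⟩
    exact hno q hq hq1 hq2 x hx (fun j => hIcc.mp (hxo j))

/-- The map of `{1,…,2k+2}` that fixes `k + 2`, takes prescribed values at `1` and at the other
points of `{k-1,…,k+5}`, and is the Stefan pattern elsewhere. -/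
def centralMap (k p a b c d e g j : ℕ) : ℕ :=
  if j ≤ 1 then p else if j ≤ k - 2 then 2 * k + 4 - j else if j ≤ k - 1 then a
  else if j ≤ k then b else if j ≤ k + 1 then c else if j ≤ k + 2 then k + 2
  else if j ≤ k + 3 then d else if j ≤ k + 4 then e else if j ≤ k + 5 then g
  else 2 * k + 3 - j

/-- The number of steps to `1` under a `centralMap`, with prescribed central values. -/
def centralTime (k a b c d e g j : ℕ) : ℕ :=
  if j ≤ k - 2 then 2 * (j - 1) else if j ≤ k - 1 then a else if j ≤ k then b
  else if j ≤ k + 1 then c else if j ≤ k + 3 then d else if j ≤ k + 4 then e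
  else if j ≤ k + 5 then g else 2 * (2 * k + 3 - j) - 1

/-- The potential of the interval `[j, j + 1]`, with prescribed values next to the center. -/
def centralPotential (k : ℕ) (u v : ℤ) (j : ℕ) : ℤ :=
  if j ≤ k - 1 then 2 * (k - j) else if j ≤ k then u else if j ≤ k + 1 then 0
  else if j ≤ k + 2 then 1 else if j ≤ k + 3 then v else 2 * (j - k) - 5

section centralMap

variable {k : ℕ} (p a b c d e g : ℕ)

theorem centralMap_one : centralMap k p a b c d e g 1 = p := by
  simp [centralMap]

theorem centralMap_left {j : ℕ} (h1 : 2 ≤ j) (h2 : j ≤ k - 2) :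
    centralMap k p a b c d e g j = 2 * k + 4 - j := by
  rw [centralMap, if_neg (by omega), if_pos (by omega)]

theorem centralMap_right {j : ℕ} (h : k + 6 ≤ j) :
    centralMap k p a b c d e g j = 2 * k + 3 - j := by
  unfold centralMap
  iterate 9 rw [if_neg (by omega)]

theorem centralMap_center (hk : 4 ≤ k) :
    centralMap k p a b c d e g (k - 1) = a ∧ centralMap k p a b c d e g k = b ∧
    centralMap k p a b c d e g (k + 1) = c ∧ centralMap k p a b c d e g (k + 2) = k + 2 ∧
    centralMap k p a b c d e g (k + 3) = d ∧ centralMap k p a b c d e g (k + 4) = e ∧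
    centralMap k p a b c d e g (k + 5) = g := by
  unfold centralMap
  refine ⟨?_, ?_, ?_, ?_, ?_, ?_, ?_⟩
  · iterate 2 rw [if_neg (by omega)]
    rw [if_pos le_rfl]
  · iterate 3 rw [if_neg (by omega)]
    rw [if_pos le_rfl]
  · iterate 4 rw [if_neg (by omega)]
    rw [if_pos le_rfl]
  · iterate 5 rw [if_neg (by omega)]
    rw [if_pos le_rfl]
  · iterate 6 rw [if_neg (by omega)]
    rw [if_pos le_rfl]
  · iterate 7 rw [if_neg (by omega)]
    rw [if_pos le_rfl]
  · iterate 8 rw [if_neg (by omega)]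
    rw [if_pos le_rfl]

end centralMap

section centralTime

variable {k : ℕ} (a b c d e g : ℕ)

theorem centralTime_left {j : ℕ} (h : j ≤ k - 2) :
    centralTime k a b c d e g j = 2 * (j - 1) := by
  rw [centralTime, if_pos h]

theorem centralTime_right {j : ℕ} (h : k + 6 ≤ j) :
    centralTime k a b c d e g j = 2 * (2 * k + 3 - j) - 1 := by
  unfold centralTime
  iterate 7 rw [if_neg (by omega)]

theorem centralTime_center (hk : 4 ≤ k) :
    centralTime k a b c d e g (k - 1) = a ∧ centralTime k a b c d e g k = b ∧
    centralTime k a b c d e g (k + 1) = c ∧ centralTime k a b c d e g (k + 3) = d ∧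
    centralTime k a b c d e g (k + 4) = e ∧ centralTime k a b c d e g (k + 5) = g := by
  unfold centralTime
  refine ⟨?_, ?_, ?_, ?_, ?_, ?_⟩
  · rw [if_neg (by omega), if_pos le_rfl]
  · iterate 2 rw [if_neg (by omega)]
    rw [if_pos le_rfl]
  · iterate 3 rw [if_neg (by omega)]
    rw [if_pos le_rfl]
  · iterate 4 rw [if_neg (by omega)]
    rw [if_pos le_rfl]
  · iterate 5 rw [if_neg (by omega)]
    rw [if_pos le_rfl]
  · iterate 6 rw [if_neg (by omega)]
    rw [if_pos le_rfl]

end centralTime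

theorem centralPotential_left {k : ℕ} (u v : ℤ) {j : ℕ} (h : j ≤ k - 1) :
    centralPotential k u v j = 2 * (k - j) := by
  rw [centralPotential, if_pos h]

theorem centralPotential_right {k : ℕ} (u v : ℤ) {j : ℕ} (h : k + 4 ≤ j) :
    centralPotential k u v j = 2 * (j - k) - 5 := by
  unfold centralPotential
  iterate 5 rw [if_neg (by omega)]

theorem centralPotential_center {k : ℕ} (hk : 4 ≤ k) (u v : ℤ) :
    centralPotential k u v k = u ∧ centralPotential k u v (k + 1) = 0 ∧
    centralPotential k u v (k + 2) = 1 ∧ centralPotential k u v (k + 3) = v := by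
  unfold centralPotential
  refine ⟨?_, ?_, ?_, ?_⟩
  · rw [if_neg (by omega), if_pos le_rfl]
  · iterate 2 rw [if_neg (by omega)]
    rw [if_pos le_rfl]
  · iterate 3 rw [if_neg (by omega)]
    rw [if_pos le_rfl]
  · iterate 4 rw [if_neg (by omega)]
    rw [if_pos le_rfl]

/-- The positive integers, sorted by the clauses of `centralMap`. -/
theorem central_position {k : ℕ} (hk : 4 ≤ k) (j : ℕ) (hj : 1 ≤ j) :
    j = 1 ∨ (2 ≤ j ∧ j ≤ k - 2) ∨ j = k - 1 ∨ k = j ∨ j = k + 1 ∨ j = k + 2 ∨ j = k + 3 ∨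
      j = k + 4 ∨ j = k + 5 ∨ k + 6 ≤ j := by
  omega

theorem isCountdown_centralMap {k : ℕ} (hk : 4 ≤ k) {p a b c d e g ta tb tc td te tg : ℕ}
    (hmaps : ∀ m ∈ [p, a, b, c, d, e, g], 1 ≤ m ∧ m ≤ 2 * k + 2 ∧ m ≠ k + 2)
    (htime : ∀ t ∈ [ta, tb, tc, td, te, tg], 2 * k - 5 ≤ t ∧ t ≤ 2 * k)
    (hnodup : [ta, tb, tc, td, te, tg].Nodup)
    (hp : centralTime k ta tb tc td te tg p = 2 * k)
    (ha : centralTime k ta tb tc td te tg a + 1 = ta)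
    (hb : centralTime k ta tb tc td te tg b + 1 = tb)
    (hc : centralTime k ta tb tc td te tg c + 1 = tc)
    (hd : centralTime k ta tb tc td te tg d + 1 = td)
    (he : centralTime k ta tb tc td te tg e + 1 = te)
    (hg : centralTime k ta tb tc td te tg g + 1 = tg) :
    IsCountdown k (centralMap k p a b c d e g) (centralTime k ta tb tc td te tg) := by
  have F1 := centralMap_one (k := k) p a b c d e g
  have Fl := fun j => @centralMap_left k p a b c d e g j
  have Fr := fun j => @centralMap_right k p a b c d e g j
  obtain ⟨Fa, Fb, Fc, Ff, Fd, Fe, Fg⟩ := centralMap_center p a b c d e g hk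
  have Tl := fun j => @centralTime_left k ta tb tc td te tg j
  have Tr := fun j => @centralTime_right k ta tb tc td te tg j
  obtain ⟨Ta, Tb, Tc, Td, Te, Tg⟩ := centralTime_center ta tb tc td te tg hk
  generalize centralMap k p a b c d e g = F at *
  generalize centralTime k ta tb tc td te tg = τ at *
  simp only [List.forall_mem_cons, List.not_mem_nil, false_imp_iff, implies_true, and_true]
    at hmaps
  obtain ⟨m1, m2, m3, m4, m5, m6, m7⟩ := hmaps
  constructor
  · intro j h1 h2 h3
    rcases central_position hk j h1 with
      rfl | h | rfl | rfl | rfl | rfl | rfl | rfl | rfl | h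
    · rwa [F1]
    · rw [Fl j h.1 h.2]; omega
    · rwa [Fa]
    · rwa [Fb]
    · rwa [Fc]
    · exact absurd rfl h3
    · rwa [Fd]
    · rwa [Fe]
    · rwa [Fg]
    · rw [Fr j h]; omega
  · clear F1 Fl Fr Fa Fb Fc Ff Fd Fe Fg hp ha hb hc hd he hg m1 m2 m3 m4 m5 m6 m7
    have hT : ∀ j, 1 ≤ j → j ≠ k + 2 → (j ≤ k - 2 ∧ τ j = 2 * (j - 1)) ∨
        (k + 6 ≤ j ∧ τ j = 2 * (2 * k + 3 - j) - 1) ∨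
        ∃ m : Fin 6, j = ![k - 1, k, k + 1, k + 3, k + 4, k + 5] m ∧
          τ j = [ta, tb, tc, td, te, tg].get m := by
      intro j h1 h3
      rcases central_position hk j h1 with
        rfl | h | rfl | rfl | rfl | rfl | rfl | rfl | rfl | h
      · exact Or.inl ⟨by omega, Tl 1 (by omega)⟩
      · exact Or.inl ⟨h.2, Tl j h.2⟩
      · exact Or.inr (Or.inr ⟨0, rfl, Ta⟩)
      · exact Or.inr (Or.inr ⟨1, rfl, Tb⟩)
      · exact Or.inr (Or.inr ⟨2, rfl, Tc⟩)
      · exact absurd rfl h3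
      · exact Or.inr (Or.inr ⟨3, rfl, Td⟩)
      · exact Or.inr (Or.inr ⟨4, rfl, Te⟩)
      · exact Or.inr (Or.inr ⟨5, rfl, Tg⟩)
      · exact Or.inr (Or.inl ⟨h, Tr j h⟩)
    have hget (m : Fin 6) := htime _ (List.get_mem [ta, tb, tc, td, te, tg] m)
    intro i j i1 i2 i3 j1 j2 j3 hij
    clear Ta Tb Tc Td Te Tg Tl Tr htime
    rcases hT i i1 i3 with h | h | ⟨m, h, hm⟩ <;>
      rcases hT j j1 j3 with h' | h' | ⟨n, h', hn⟩
    any_goals omega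
    · have := hget n; omega
    · have := hget n; omega
    · have := hget m; omega
    · have := hget m; omega
    · rw [hij, hn] at hm
      rw [h, h', List.nodup_iff_injective_get.1 hnodup hm]
  · intro j h1 h2 h3
    rcases central_position hk j h1 with
      rfl | h | rfl | rfl | rfl | rfl | rfl | rfl | rfl | h
    · rw [Tl 1 (by omega)]; omega
    · rw [Tl j h.2]; omega
    · rw [Ta]; exact (htime _ (by simp)).2
    · rw [Tb]; exact (htime _ (by simp)).2
    · rw [Tc]; exact (htime _ (by simp)).2
    · exact absurd rfl h3
    · rw [Td]; exact (htime _ (by simp)).2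
    · rw [Te]; exact (htime _ (by simp)).2
    · rw [Tg]; exact (htime _ (by simp)).2
    · rw [Tr j h]; omega
  · exact Tl 1 (by omega)
  · rw [F1, hp]
  · intro j h1 h2 h3
    rcases central_position hk j (by omega) with
      rfl | h | rfl | rfl | rfl | rfl | rfl | rfl | rfl | h
    · omega
    · rw [Fl j h.1 h.2, Tl j h.2, Tr _ (by omega)]; omega
    · rw [Fa, Ta, ha]
    · rw [Fb, Tb, hb]
    · rw [Fc, Tc, hc]
    · exact absurd rfl h3
    · rw [Fd, Td, hd]
    · rw [Fe, Te, he]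
    · rw [Fg, Tg, hg]
    · rw [Fr j h, Tr j h, Tl _ (by omega)]; omega

theorem centralPotential_edge {k : ℕ} (hk : 4 ≤ k) {p a b c e g : ℕ} {u v : ℤ}
    (hp : k ≤ p) (ha : k + 3 ≤ a) (ha' : a ≤ k + 5)
    (hb : k + 3 ≤ b) (hb' : b ≤ k + 5) (hc : k + 3 ≤ c) (hc' : c ≤ k + 4)
    (he : k - 2 ≤ e) (he' : e ≤ k + 1) (hg : k - 2 ≤ g) (hg' : g ≤ k + 1)
    (hpu : p = k → u = 0) (hu : u = 2 ∨ u = 0 ∧ b ≤ k + 4 ∧ v = 1)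
    (hv : v = 3 ∨ v = 1 ∧ k - 1 ≤ e) (hcv : c = k + 3 ∨ v = 1)
    {i j : ℕ} (i1 : 1 ≤ i) (i2 : i ≤ 2 * k + 1) (j1 : 1 ≤ j) (j2 : j ≤ 2 * k + 1)
    (hij : centralMap k p a b c (k - 1) e g i ≤ j ∧
        j + 1 ≤ centralMap k p a b c (k - 1) e g (i + 1) ∨
      centralMap k p a b c (k - 1) e g (i + 1) ≤ j ∧
        j + 1 ≤ centralMap k p a b c (k - 1) e g i) :
    ((j ≤ k + 1 ↔ ¬ i ≤ k + 1) ∧ centralPotential k u v j ≤ centralPotential k u v i + 1) ∨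
    ((j ≤ k + 1 ↔ i ≤ k + 1) ∧
      centralPotential k u v j + (2 * k - 2) ≤ centralPotential k u v i) := by
  have F1 := centralMap_one (k := k) p a b c (k - 1) e g
  have Fl := fun j => @centralMap_left k p a b c (k - 1) e g j
  have Fr := fun j => @centralMap_right k p a b c (k - 1) e g j
  obtain ⟨Fa, Fb, Fc, Ff, Fd, Fe, Fg⟩ := centralMap_center p a b c (k - 1) e g hk
  obtain ⟨H1, H2, H3, H4⟩ := centralPotential_center hk u v
  have Hl := fun j => @centralPotential_left k u v j
  have Hr := fun j => @centralPotential_right k u v j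
  generalize centralMap k p a b c (k - 1) e g = F at *
  generalize centralPotential k u v = h at *
  have hpos : ∀ j, j ≤ k - 1 ∨ k = j ∨ j = k + 1 ∨ j = k + 2 ∨ j = k + 3 ∨ k + 4 ≤ j := by omega
  rcases central_position hk i i1 with
    rfl | hi | rfl | rfl | rfl | rfl | rfl | rfl | rfl | hi
  · rw [F1, Fl 2 le_rfl (by omega)] at hij
    rw [Hl 1 (by omega)]
    clear Fa Fb Fc Ff Fd Fe Fg F1
    rcases hpos j with hj | rfl | rfl | rfl | rfl | hj
    · omega
    · rw [H1]; omega
    · rw [H2]; omega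
    · rw [H3]; omega
    · rw [H4]; omega
    · rw [Hr j hj]; omega
  · rw [Fl i hi.1 hi.2] at hij
    rw [Hl i (by omega)]
    have hj : k + 3 ≤ j ∧ j ≤ 2 * k + 3 - i := by
      rcases hi.2.lt_or_eq with hlt | heq
      · rw [Fl (i + 1) (by omega) (by omega)] at hij; omega
      · rw [show i + 1 = k - 1 by omega, Fa] at hij; omega
    clear Fa Fb Fc Ff Fd Fe Fg F1 hij
    rcases hpos j with hj | rfl | rfl | rfl | rfl | hj
    any_goals omega
    rw [Hr j hj]; omega
  · rw [Nat.sub_add_cancel (by omega), Fa, Fb] at hij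
    rw [Hl (k - 1) le_rfl]
    have hj : k + 3 ≤ j ∧ j ≤ k + 4 := by omega
    clear Fa Fb Fc Ff Fd Fe Fg F1 hij
    rcases hpos j with hj | rfl | rfl | rfl | rfl | hj
    any_goals omega
    rw [Hr j hj]; omega
  · rw [Fb, Fc] at hij
    rw [H1]
    have hj : k + 3 ≤ j ∧ (j = k + 3 ∨ j = k + 4 ∧ b = k + 5) := by omega
    clear Fa Fb Fc Ff Fd Fe Fg F1 hij
    rcases hj.2 with rfl | ⟨rfl, _⟩
    · rw [H4]; omega
    · rw [Hr _ le_rfl]; omega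
  · rw [Fc, Ff] at hij
    rw [H2]
    have hj : j = k + 2 ∨ j = k + 3 ∧ c = k + 4 := by omega
    clear Fa Fb Fc Ff Fd Fe Fg F1 hij
    rcases hj with rfl | ⟨rfl, _⟩
    · rw [H3]; omega
    · rw [H4]; omega
  · rw [Ff, Fd] at hij
    rw [H3]
    have hj : j = k - 1 ∨ k = j ∨ j = k + 1 := by omega
    clear Fa Fb Fc Ff Fd Fe Fg F1 hij
    rcases hj with rfl | rfl | rfl
    · rw [Hl _ le_rfl]; omega
    · rw [H1]; omega
    · rw [H2]; omega
  · rw [Fd, Fe] at hij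
    rw [H4]
    have hj : j = k - 2 ∧ e = k - 2 ∨ j = k - 1 ∨ k = j := by omega
    clear Fa Fb Fc Ff Fd Fe Fg F1 hij
    rcases hj with ⟨rfl, _⟩ | rfl | rfl
    · rw [Hl _ (by omega)]; omega
    · rw [Hl _ le_rfl]; omega
    · rw [H1]; omega
  · rw [Fe, Fg] at hij
    rw [Hr _ le_rfl]
    have hj : k - 2 ≤ j ∧ j ≤ k - 1 ∨ k = j := by omega
    clear Fa Fb Fc Ff Fd Fe Fg F1 hij
    rcases hj with hj | rfl
    · rw [Hl _ (by omega)]; omega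
    · rw [H1]; omega
  · rw [Fg, Fr _ le_rfl] at hij
    rw [Hr (k + 5) (by omega)]
    have hj : k - 3 ≤ j ∧ j ≤ k - 1 ∨ k = j := by omega
    clear Fa Fb Fc Ff Fd Fe Fg F1 hij
    rcases hj with hj | rfl
    · rw [Hl _ (by omega)]; omega
    · rw [H1]; omega
  · rw [Fr i hi, Fr (i + 1) (by omega)] at hij
    rw [Hr i (by omega), Hl j (by omega)]
    omega

/-- It suffices to compare `centralMap` with a permutation at the central points, if the
permutation is the Stefan permutation elsewhere. -/
theorem centralMap_orbitPos {k : ℕ} (hk : 4 ≤ k) {p a b c d e g : ℕ} {π : ℕ → ℕ}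
    (hp : p = orbitPos k (π 1)) (ha : a = orbitPos k (π (k - 1))) (hb : b = orbitPos k (π k))
    (hc : c = orbitPos k (π (k + 1))) (hd : d = orbitPos k (π (k + 2)))
    (he : e = orbitPos k (π (k + 3))) (hg : g = orbitPos k (π (k + 4)))
    (hl : ∀ t, 2 ≤ t → t ≤ k - 2 → π t = stefanPerm k t)
    (hr : ∀ t, k + 5 ≤ t → π t = stefanPerm k t) {t : ℕ} (h1 : 1 ≤ t) (h2 : t ≤ 2 * k + 1) :
    centralMap k p a b c d e g (orbitPos k t) = orbitPos k (π t) := by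
  obtain ⟨Fa, Fb, Fc, -, Fd, Fe, Fg⟩ := centralMap_center p a b c d e g hk
  have left (s : ℕ) (hs : s ≤ k + 1) : orbitPos k s = s := if_pos hs
  have right (s : ℕ) (hs : k + 2 ≤ s) : orbitPos k s = s + 1 := if_neg (by omega)
  rcases central_position hk t h1 with
    rfl | h | rfl | rfl | rfl | rfl | rfl | rfl | rfl | h
  · rw [← hp, left 1 (by omega), centralMap_one]
  · rw [hl t h.1 h.2, stefanPerm, if_neg (by omega), if_pos (by omega), left t (by omega),
      right _ (by omega), centralMap_left _ _ _ _ _ _ _ h.1 h.2]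
    omega
  · rw [← ha, left _ (by omega), Fa]
  · rw [← hb, left _ (by omega), Fb]
  · rw [← hc, left _ (by omega), Fc]
  · rw [← hd, right _ (by omega), Fd]
  · rw [← he, right _ (by omega), Fe]
  · rw [← hg, right _ (by omega), Fg]
  · rw [hr _ le_rfl, stefanPerm, if_neg (by omega), if_neg (by omega), right (k + 5) (by omega),
      left _ (by omega), centralMap_right _ _ _ _ _ _ _ le_rfl]
    omega
  · rw [hr _ (by omega), stefanPerm, if_neg (by omega), if_neg (by omega), right t (by omega),
      left _ (by omega), centralMap_right _ _ _ _ _ _ _ (by omega)]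
    omega

/-- A spiral map with suitable central values is realized by a second minimal orbit. -/
theorem realizedSM_of_centralMap {k : ℕ} (hk : 4 ≤ k) {π : ℕ → ℕ}
    {p a b c e g ta tb tc td te tg w : ℕ} {u v : ℤ}
    (hτ : IsCountdown k (centralMap k p a b c (k - 1) e g) (centralTime k ta tb tc td te tg))
    (hw : w = k - 1 ∧ ta = 2 * k - 4 ∨ k = w ∧ tb = 2 * k - 4)
    (hp : k ≤ p) (hp' : p ≤ k + 1) (ha : k + 3 ≤ a) (ha' : a ≤ k + 5)
    (hb : k + 3 ≤ b) (hb' : b ≤ k + 5) (hc : k + 3 ≤ c) (hc' : c ≤ k + 4)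
    (he : k - 2 ≤ e) (he' : e ≤ k + 1) (hg : k - 2 ≤ g) (hg' : g ≤ k + 1)
    (hpu : p = k → u = 0) (hu : u = 2 ∨ u = 0 ∧ b ≤ k + 4 ∧ v = 1)
    (hv : v = 3 ∨ v = 1 ∧ k - 1 ≤ e) (hcv : c = k + 3 ∨ v = 1)
    (hπp : p = orbitPos k (π 1)) (hπa : a = orbitPos k (π (k - 1)))
    (hπb : b = orbitPos k (π k)) (hπc : c = orbitPos k (π (k + 1)))
    (hπd : k - 1 = orbitPos k (π (k + 2))) (hπe : e = orbitPos k (π (k + 3)))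
    (hπg : g = orbitPos k (π (k + 4)))
    (hl : ∀ t, 2 ≤ t → t ≤ k - 2 → π t = stefanPerm k t)
    (hr : ∀ t, k + 5 ≤ t → π t = stefanPerm k t) :
    RealizedSM k π := by
  have hπ (t : ℕ) (h1 : 1 ≤ t) (h2 : t ≤ 2 * k + 1) :=
    centralMap_orbitPos hk hπp hπa hπb hπc hπd hπe hπg hl hr h1 h2
  clear hπp hπa hπb hπc hπd hπe hπg hl hr
  obtain ⟨-, -, Fc, Ff, Fd, -, -⟩ := centralMap_center p a b c (k - 1) e g hk
  obtain ⟨Ta, Tb, -, -, -, -⟩ := centralTime_center ta tb tc td te tg hk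
  refine realizedSM_of_potential hk (v := w) hτ ?_ hπ (by rw [centralMap_one]; omega)
    (by rw [centralMap_one]; omega)
    (by rw [centralMap_left _ _ _ _ _ _ _ le_rfl (by omega)]; omega)
    (by omega) Ff Fd (by omega) (by omega) ?_
    (fun i j i1 i2 j1 j2 hij => centralPotential_edge hk hp ha ha' hb hb' hc hc' he he' hg hg'
      hpu hu hv hcv i1 i2 j1 j2 hij)
  · intro t h1 h2
    obtain ⟨t1, t2, t3⟩ := orbitPos_mem h1 h2
    have h3 := hτ.maps _ t1 t2 t3
    rw [hπ t h1 h2] at h3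
    unfold orbitPos at h3
    split_ifs at h3 <;> omega
  · rcases hw with ⟨rfl, h⟩ | ⟨rfl, h⟩
    · rw [Ta, h]
    · rw [Tb, h]

theorem realizedSM_stefanPerm_update_k_kp1_kp2_kp3 (k : ℕ) (hk : 4 ≤ k) :
    RealizedSM k (fun t =>
      if t = k then k+2 else if t = k+1 then k+3 else if t = k+2 then k-1
      else if t = k+3 then k else stefanPerm k t) := by
  obtain ⟨Ta, Tb, Tc, Td, Te, Tg⟩ :=
    centralTime_center (2 * k - 4) (2 * k - 2) (2 * k) (2 * k - 3) (2 * k - 1) (2 * k - 5) hk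
  have Tl :=
    centralTime_left (2 * k - 4) (2 * k - 2) (2 * k) (2 * k - 3) (2 * k - 1) (2 * k - 5)
      (le_refl (k - 2))
  refine realizedSM_of_centralMap hk (p := k + 1) (a := k + 5) (b := k + 3) (c := k + 4) (e := k)
    (g := k - 2) (w := k - 1) (u := 2) (v := 1) (isCountdown_centralMap hk ?_ ?_ ?_
    Tc (by rw [Tg]; omega) (by rw [Td]; omega)
    (by rw [Te]; omega) (by rw [Ta]; omega) (by rw [Tb]; omega)
    (by rw [Tl]; omega))
    (Or.inl ⟨rfl, rfl⟩) (by omega) (by omega) (by omega) (by omega) (by omega) (by omega)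
    (by omega) (by omega) (by omega) (by omega) (by omega) (by omega) (by omega)
    (Or.inl rfl) (Or.inr ⟨rfl, by omega⟩) (Or.inr rfl) ?_ ?_ ?_ ?_ ?_ ?_ ?_ ?_ ?_
  all_goals clear Ta Tb Tc Td Te Tg Tl
  · simp only [List.forall_mem_cons, List.not_mem_nil, false_imp_iff, implies_true, and_true]
    omega
  · simp only [List.forall_mem_cons, List.not_mem_nil, false_imp_iff, implies_true, and_true]
    omega
  · simp only [List.nodup_cons, List.mem_cons, List.not_mem_nil, or_false, not_or,
      not_false_eq_true, List.nodup_nil, and_true]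
    omega
  iterate 7 (simp only [stefanPerm, orbitPos]; split_ifs <;> omega)
  · intro t h1 h2
    iterate 4 rw [if_neg (by omega)]
  · intro t h
    iterate 4 rw [if_neg (by omega)]

theorem realizedSM_stefanPerm_update_kp2_kp3_kp4 (k : ℕ) (hk : 4 ≤ k) :
    RealizedSM k (fun t =>
      if t = k+2 then k-1 else if t = k+3 then k-2 else if t = k+4 then k
      else stefanPerm k t) := by
  obtain ⟨Ta, Tb, Tc, Td, Te, Tg⟩ :=
    centralTime_center (2 * k - 2) (2 * k - 4) (2 * k) (2 * k - 1) (2 * k - 5) (2 * k - 3) hk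
  have Tl :=
    centralTime_left (2 * k - 2) (2 * k - 4) (2 * k) (2 * k - 1) (2 * k - 5) (2 * k - 3)
      (le_refl (k - 2))
  refine realizedSM_of_centralMap hk (p := k + 1) (a := k + 5) (b := k + 4) (c := k + 3) (e := k - 2)
    (g := k) (w := k) (u := 2) (v := 3) (isCountdown_centralMap hk ?_ ?_ ?_
    Tc (by rw [Tg]; omega) (by rw [Te]; omega)
    (by rw [Td]; omega) (by rw [Ta]; omega) (by rw [Tl]; omega)
    (by rw [Tb]; omega))
    (Or.inr ⟨rfl, rfl⟩) (by omega) (by omega) (by omega) (by omega) (by omega) (by omega)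
    (by omega) (by omega) (by omega) (by omega) (by omega) (by omega) (by omega)
    (Or.inl rfl) (Or.inl rfl) (Or.inl rfl) ?_ ?_ ?_ ?_ ?_ ?_ ?_ ?_ ?_
  all_goals clear Ta Tb Tc Td Te Tg Tl
  · simp only [List.forall_mem_cons, List.not_mem_nil, false_imp_iff, implies_true, and_true]
    omega
  · simp only [List.forall_mem_cons, List.not_mem_nil, false_imp_iff, implies_true, and_true]
    omega
  · simp only [List.nodup_cons, List.mem_cons, List.not_mem_nil, or_false, not_or,
      not_false_eq_true, List.nodup_nil, and_true]
    omega
  iterate 7 (simp only [stefanPerm, orbitPos]; split_ifs <;> omega)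
  · intro t h1 h2
    iterate 3 rw [if_neg (by omega)]
  · intro t h
    iterate 3 rw [if_neg (by omega)]

theorem realizedSM_stefanPerm_update_one_kp2_kp3 (k : ℕ) (hk : 4 ≤ k) :
    RealizedSM k (fun t =>
      if t = 1 then k else if t = k+2 then k-1 else if t = k+3 then k+1
      else stefanPerm k t) := by
  obtain ⟨Ta, Tb, Tc, Td, Te, Tg⟩ :=
    centralTime_center (2 * k - 4) (2 * k) (2 * k - 2) (2 * k - 3) (2 * k - 1) (2 * k - 5) hk
  have Tl :=
    centralTime_left (2 * k - 4) (2 * k) (2 * k - 2) (2 * k - 3) (2 * k - 1) (2 * k - 5)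
      (le_refl (k - 2))
  refine realizedSM_of_centralMap hk (p := k) (a := k + 5) (b := k + 4) (c := k + 3) (e := k + 1)
    (g := k - 2) (w := k - 1) (u := 0) (v := 1) (isCountdown_centralMap hk ?_ ?_ ?_
    Tb (by rw [Tg]; omega) (by rw [Te]; omega)
    (by rw [Td]; omega) (by rw [Ta]; omega) (by rw [Tc]; omega)
    (by rw [Tl]; omega))
    (Or.inl ⟨rfl, rfl⟩) (by omega) (by omega) (by omega) (by omega) (by omega) (by omega)
    (by omega) (by omega) (by omega) (by omega) (by omega) (by omega) (fun _ => rfl)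
    (Or.inr ⟨rfl, le_rfl, rfl⟩) (Or.inr ⟨rfl, by omega⟩) (Or.inl rfl) ?_ ?_ ?_ ?_ ?_ ?_ ?_ ?_ ?_
  all_goals clear Ta Tb Tc Td Te Tg Tl
  · simp only [List.forall_mem_cons, List.not_mem_nil, false_imp_iff, implies_true, and_true]
    omega
  · simp only [List.forall_mem_cons, List.not_mem_nil, false_imp_iff, implies_true, and_true]
    omega
  · simp only [List.nodup_cons, List.mem_cons, List.not_mem_nil, or_false, not_or,
      not_false_eq_true, List.nodup_nil, and_true]
    omega
  iterate 7 (simp only [stefanPerm, orbitPos]; split_ifs <;> omega)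
  · intro t h1 h2
    iterate 3 rw [if_neg (by omega)]
  · intro t h
    iterate 3 rw [if_neg (by omega)]

theorem realizedSM_stefanPerm_update_km1_k_kp2_kp3 (k : ℕ) (hk : 4 ≤ k) :
    RealizedSM k (fun t =>
      if t = k-1 then k+3 else if t = k then k+4 else if t = k+2 then k-1
      else if t = k+3 then k else stefanPerm k t) := by
  obtain ⟨Ta, Tb, Tc, Td, Te, Tg⟩ :=
    centralTime_center (2 * k - 2) (2 * k - 4) (2 * k) (2 * k - 1) (2 * k - 3) (2 * k - 5) hk
  have Tl :=
    centralTime_left (2 * k - 2) (2 * k - 4) (2 * k) (2 * k - 1) (2 * k - 3) (2 * k - 5)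
      (le_refl (k - 2))
  refine realizedSM_of_centralMap hk (p := k + 1) (a := k + 4) (b := k + 5) (c := k + 3) (e := k)
    (g := k - 2) (w := k) (u := 2) (v := 3) (isCountdown_centralMap hk ?_ ?_ ?_
    Tc (by rw [Te]; omega) (by rw [Tg]; omega)
    (by rw [Td]; omega) (by rw [Ta]; omega) (by rw [Tb]; omega)
    (by rw [Tl]; omega))
    (Or.inr ⟨rfl, rfl⟩) (by omega) (by omega) (by omega) (by omega) (by omega) (by omega)
    (by omega) (by omega) (by omega) (by omega) (by omega) (by omega) (by omega)
    (Or.inl rfl) (Or.inl rfl) (Or.inl rfl) ?_ ?_ ?_ ?_ ?_ ?_ ?_ ?_ ?_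
  all_goals clear Ta Tb Tc Td Te Tg Tl
  · simp only [List.forall_mem_cons, List.not_mem_nil, false_imp_iff, implies_true, and_true]
    omega
  · simp only [List.forall_mem_cons, List.not_mem_nil, false_imp_iff, implies_true, and_true]
    omega
  · simp only [List.nodup_cons, List.mem_cons, List.not_mem_nil, or_false, not_or,
      not_false_eq_true, List.nodup_nil, and_true]
    omega
  iterate 7 (simp only [stefanPerm, orbitPos]; split_ifs <;> omega)
  · intro t h1 h2
    iterate 4 rw [if_neg (by omega)]
  · intro t h
    iterate 4 rw [if_neg (by omega)]

/-- The four second minimal permutations arising from setting `(k, k+1)`. -/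
theorem realized_setting_k_kp1 (k : ℕ) (hk : 4 ≤ k) :
    RealizedSM k (fun t =>
      if t = k then k+2 else if t = k+1 then k+3 else if t = k+2 then k-1
      else if t = k+3 then k else stefanPerm k t) ∧
    RealizedSM k (fun t =>
      if t = k+2 then k-1 else if t = k+3 then k-2 else if t = k+4 then k
      else stefanPerm k t) ∧
    RealizedSM k (fun t =>
      if t = 1 then k else if t = k+2 then k-1 else if t = k+3 then k+1
      else stefanPerm k t) ∧
    RealizedSM k (fun t =>
      if t = k-1 then k+3 else if t = k then k+4 else if t = k+2 then k-1
      else if t = k+3 then k else stefanPerm k t) :=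
  ⟨realizedSM_stefanPerm_update_k_kp1_kp2_kp3 k hk, realizedSM_stefanPerm_update_kp2_kp3_kp4 k hk,
    realizedSM_stefanPerm_update_one_kp2_kp3 k hk, realizedSM_stefanPerm_update_km1_k_kp2_kp3 k hk⟩
end
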